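/- arXiv:2602.23291 — 15 statements merged into one kernel-verified Lean document; each statement's English description precedes it below -/
import Mathlib

section
/- Let n ≥ 2 and let W be a connected proximity matrix with D its diagonal matrix of (positive) column sums and D^{-1/2} W D^{-1/2} = Γ Λ Γᵀ a spectral decomposition. Let (β, τ_U, φ_U, τ_Z, φ_Z, ρ, τ_ε) and (β̃, τ̃_U, φ̃_U, τ̃_Z, φ̃_Z, ρ̃, τ̃_ε) be real parameters with τ_U, τ̃_U, τ_Z, τ̃_Z, τ_ε, τ̃_ε > 0, ρ, ρ̃ ∈ (−1,1), and with I − φ_U Λ and I − φ̃_U Λ positive definite. Assume φ_U ≠ 0, assume that either W has at least three distinct eigenvalues or D has two distinct diagonal entries, and assume the three matrix identities: (a) β I + ρ √(τ_Z/τ_U) (I − φ_U Λ)^{-1} = β̃ I + ρ̃ √(τ̃_Z/τ̃_U) (I − φ̃_U Λ)^{-1}; (b) τ_U^{-1} (I − φ_U Λ)^{-1} + τ_ε^{-1} Γᵀ D Γ = τ̃_U^{-1} (I − φ̃_U Λ)^{-1} + τ̃_ε^{-1} Γᵀ D Γ; (c) τ_Z (I − φ_Z Λ − ρ² (I − φ_U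 Λ)^{-1}) = τ̃_Z (I − φ̃_Z Λ − ρ̃² (I − φ̃_U Λ)^{-1}). Then β̃ = β, τ̃_U = τ_U, φ̃_U = φ_U, τ̃_Z = τ_Z, φ̃_Z = φ_Z, ρ̃ = ρ, and τ̃_ε = τ_ε. -/
open Matrix

namespace CAR

variable {n : ℕ}

/-- The symmetric normalization `D^{-1/2} W D^{-1/2}` of `W` with weights `d`. -/
noncomputable def normalized (W : Matrix (Fin n) (Fin n) ℝ) (d : Fin n → ℝ) :
    Matrix (Fin n) (Fin n) ℝ :=
  (Matrix.diagonal fun i => (Real.sqrt (d i))⁻¹) * W *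
    (Matrix.diagonal fun i => (Real.sqrt (d i))⁻¹)

lemma normalized_apply (W : Matrix (Fin n) (Fin n) ℝ) (d : Fin n → ℝ) (i j : Fin n) :
    normalized W d i j = (Real.sqrt (d i))⁻¹ * W i j * (Real.sqrt (d j))⁻¹ := by
  simp [normalized, Matrix.mul_diagonal, Matrix.diagonal_mul]

lemma normalized_const (W : Matrix (Fin n) (Fin n) ℝ) {d : Fin n → ℝ} {δ : ℝ} (hδ : 0 < δ)
    (hd : ∀ i, d i = δ) : normalized W d = δ⁻¹ • W := by
  ext i j
  rw [normalized_apply, hd, hd, Matrix.smul_apply, smul_eq_mul, mul_right_comm, ← mul_inv,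
    Real.mul_self_sqrt hδ.le]

lemma normalized_ne_zero {W : Matrix (Fin n) (Fin n) ℝ} {d : Fin n → ℝ} (hn : n ≠ 0)
    (hd : ∀ i, d i = ∑ j, W j i) (hdpos : ∀ i, 0 < d i) : normalized W d ≠ 0 := by
  intro h
  have hW : ∀ i j, W i j = 0 := by
    intro i j
    have h1 := congrFun (congrFun h i) j
    rw [normalized_apply] at h1
    have hi := (Real.sqrt_pos.2 (hdpos i)).ne'
    have hj := (Real.sqrt_pos.2 (hdpos j)).ne'
    simpa [hi, hj] using h1
  let k : Fin n := ⟨0, Nat.pos_of_ne_zero hn⟩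
  have := hdpos k
  rw [hd] at this
  simp [hW] at this

/-- If the normalization of a connected `W` commutes with `D`, then `D` is a scalar matrix. -/
lemma eq_of_commute_diagonal {W : Matrix (Fin n) (Fin n) ℝ} {d : Fin n → ℝ}
    (hdpos : ∀ i, 0 < d i)
    (hWconn : ∀ i j : Fin n, i ≠ j → ∃ (m : ℕ) (l : Fin (m + 1) → Fin n),
      l 0 = i ∧ l (Fin.last m) = j ∧ ∀ r : Fin m, 0 < W (l r.castSucc) (l r.succ))
    (h : Commute (normalized W d) (Matrix.diagonal d)) (i j : Fin n) : d i = d j := by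
  have edge : ∀ i j, 0 < W i j → d i = d j := by
    intro i j hij
    have h1 := congrFun (congrFun h.eq i) j
    rw [Matrix.mul_diagonal, Matrix.diagonal_mul, mul_comm] at h1
    have hS : normalized W d i j ≠ 0 := by
      rw [normalized_apply]
      have hi := Real.sqrt_pos.2 (hdpos i)
      have hj := Real.sqrt_pos.2 (hdpos j)
      positivity
    exact (mul_right_cancel₀ hS h1).symm
  rcases eq_or_ne i j with rfl | hij
  · rfl
  obtain ⟨m, l, rfl, rfl, hl⟩ := hWconn i j hij
  have : ∀ r, d (l 0) = d (l r) := by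
    intro r
    induction r using Fin.induction with
    | zero => rfl
    | succ r ih => exact ih.trans (edge _ _ (hl r))
  exact this _

/-- A matrix with zero diagonal that is not zero is linearly independent of the identity. -/
lemma eq_zero_of_smul_one_eq_smul {S : Matrix (Fin n) (Fin n) ℝ} (hn : n ≠ 0)
    (hS0 : ∀ i, S i i = 0) (hS : S ≠ 0) {a b : ℝ}
    (h : a • (1 : Matrix (Fin n) (Fin n) ℝ) = b • S) : a = 0 ∧ b = 0 := by
  let k : Fin n := ⟨0, Nat.pos_of_ne_zero hn⟩
  have ha : a = 0 := by simpa [hS0] using congrFun (congrFun h k) k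
  refine ⟨ha, ?_⟩
  rw [ha, zero_smul] at h
  exact (smul_eq_zero.1 h.symm).resolve_right hS

lemma quadratic_coeffs_eq_zero {p q r a b c : ℝ} (hab : a ≠ b) (hac : a ≠ c) (hbc : b ≠ c)
    (ha : p + q * a + r * a ^ 2 = 0) (hb : p + q * b + r * b ^ 2 = 0)
    (hc : p + q * c + r * c ^ 2 = 0) : p = 0 ∧ q = 0 ∧ r = 0 := by
  have h1 : q + r * (a + b) = 0 :=
    mul_left_cancel₀ (sub_ne_zero.2 hab) (by linear_combination ha - hb)
  have h2 : q + r * (a + c) = 0 :=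
    mul_left_cancel₀ (sub_ne_zero.2 hac) (by linear_combination ha - hc)
  have hr : r = 0 := mul_left_cancel₀ (sub_ne_zero.2 hbc) (by linear_combination h1 - h2)
  subst hr
  have hq : q = 0 := by linear_combination h1
  subst hq
  exact ⟨by linear_combination ha, rfl, rfl⟩

/-- A polynomial of degree two vanishing at a matrix with three distinct eigenvalues is zero. -/
lemma quadratic_coeffs_eq_zero_of_eigenvalues {S : Matrix (Fin n) (Fin n) ℝ} {p q r : ℝ}
    (h : p • (1 : Matrix (Fin n) (Fin n) ℝ) + q • S + r • (S * S) = 0)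
    {a b c : ℝ} (hab : a ≠ b) (hac : a ≠ c) (hbc : b ≠ c)
    (ha : ∃ v : Fin n → ℝ, v ≠ 0 ∧ S.mulVec v = a • v)
    (hb : ∃ v : Fin n → ℝ, v ≠ 0 ∧ S.mulVec v = b • v)
    (hc : ∃ v : Fin n → ℝ, v ≠ 0 ∧ S.mulVec v = c • v) : p = 0 ∧ q = 0 ∧ r = 0 := by
  have key : ∀ x : ℝ, (∃ v : Fin n → ℝ, v ≠ 0 ∧ S.mulVec v = x • v) →
      p + q * x + r * x ^ 2 = 0 := by
    rintro x ⟨v, hv, hx⟩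
    have h1 := congrArg (fun M => M.mulVec v) h
    simp only [Matrix.add_mulVec, Matrix.smul_mulVec, Matrix.one_mulVec, ← Matrix.mulVec_mulVec,
      hx, Matrix.mulVec_smul, Matrix.zero_mulVec, smul_smul, ← add_smul] at h1
    have := (smul_eq_zero.1 h1).resolve_right hv
    linear_combination this
  exact quadratic_coeffs_eq_zero hab hac hbc (key a ha) (key b hb) (key c hc)

lemma commute_inverse {S R : Matrix (Fin n) (Fin n) ℝ} {φ : ℝ}
    (hl : (1 - φ • S) * R = 1) (hr : R * (1 - φ • S) = 1) : Commute S R := by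
  have hc : Commute S (1 - φ • S) :=
    (Commute.one_right S).sub_right ((Commute.refl S).smul_right φ)
  calc S * R = R * (1 - φ • S) * S * R := by rw [hr, one_mul]
    _ = R * S * ((1 - φ • S) * R) := by rw [mul_assoc R, ← hc.eq]; simp only [mul_assoc]
    _ = R * S := by rw [hl, mul_one]

/-- Proportional resolvents of a nonzero matrix with zero diagonal coincide. -/
lemma params_eq_of_smul_inverse_eq {S R R' : Matrix (Fin n) (Fin n) ℝ} (hn : n ≠ 0)
    (hS0 : ∀ i, S i i = 0) (hS : S ≠ 0) {φ φ' u u' : ℝ} (hu : u ≠ 0)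
    (hR : R * (1 - φ • S) = 1) (hR' : (1 - φ' • S) * R' = 1)
    (h : u • R = u' • R') : u' = u ∧ φ' = φ := by
  have h1 : u • (1 - φ' • S) = u' • (1 - φ • S) := by
    calc u • (1 - φ' • S) = (1 - φ' • S) * (u • R) * (1 - φ • S) := by
          rw [mul_smul_comm, smul_mul_assoc, mul_assoc, hR, mul_one]
      _ = u' • (1 - φ • S) := by
          rw [h, mul_smul_comm, hR', smul_mul_assoc, one_mul]
  have h2 : (u - u') • (1 : Matrix (Fin n) (Fin n) ℝ) = (u * φ' - u' * φ) • S := by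
    rw [← sub_eq_zero] at h1 ⊢
    rw [← h1]
    module
  obtain ⟨h3, h4⟩ := eq_zero_of_smul_one_eq_smul hn hS0 hS h2
  have h5 : u' = u := by linarith
  subst h5
  exact ⟨rfl, mul_left_cancel₀ hu (by linarith)⟩

end CAR

/-- Identifiability of all parameters in the CAR spatial confounding model
(Theorem 1 / `thm:car-identifiability`, reduced to its spectral form): if the
proximity matrix `W` is connected, `φ_U ≠ 0`, and either `W` has at least three
distinct eigenvalues or `D` has two distinct diagonal entries, then equality of
the three observable matrix quantities forces equality of all the parameters. -/
theorem car_identifiability {n : ℕ} (hn : 2 ≤ n)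
    (W : Matrix (Fin n) (Fin n) ℝ)
    (hWsymm : W.IsSymm)
    (hWnonneg : ∀ i j, 0 ≤ W i j)
    (hWdiag : ∀ i, W i i = 0)
    (hWconn : ∀ i j : Fin n, i ≠ j → ∃ (m : ℕ) (l : Fin (m + 1) → Fin n),
      l 0 = i ∧ l (Fin.last m) = j ∧ ∀ r : Fin m, 0 < W (l r.castSucc) (l r.succ))
    (d : Fin n → ℝ) (hd : ∀ i, d i = ∑ j, W j i) (hdpos : ∀ i, 0 < d i)
    (Γ Λ : Matrix (Fin n) (Fin n) ℝ)
    (hΓ : Γ * Γᵀ = 1) (hΓ' : Γᵀ * Γ = 1)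
    (hΛdiag : ∃ lam : Fin n → ℝ, Λ = Matrix.diagonal lam)
    (hspec : (Matrix.diagonal fun i => (Real.sqrt (d i))⁻¹) * W *
        (Matrix.diagonal fun i => (Real.sqrt (d i))⁻¹) = Γ * Λ * Γᵀ)
    (β τU φU τZ φZ ρ τε β' τU' φU' τZ' φZ' ρ' τε' : ℝ)
    (hτU : 0 < τU) (hτU' : 0 < τU') (hτZ : 0 < τZ) (hτZ' : 0 < τZ')
    (hτε : 0 < τε) (hτε' : 0 < τε')
    (hρ : ρ ∈ Set.Ioo (-1 : ℝ) 1) (hρ' : ρ' ∈ Set.Ioo (-1 : ℝ) 1)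
    (hpd : (1 - φU • Λ).PosDef) (hpd' : (1 - φU' • Λ).PosDef)
    (hφU : φU ≠ 0)
    (hEigOrD :
      (∃ a b c : ℝ, a ≠ b ∧ a ≠ c ∧ b ≠ c ∧
        (∃ v : Fin n → ℝ, v ≠ 0 ∧ W.mulVec v = a • v) ∧
        (∃ v : Fin n → ℝ, v ≠ 0 ∧ W.mulVec v = b • v) ∧
        (∃ v : Fin n → ℝ, v ≠ 0 ∧ W.mulVec v = c • v)) ∨
      (∃ i j : Fin n, d i ≠ d j))
    (ha : β • (1 : Matrix (Fin n) (Fin n) ℝ) +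
        (ρ * Real.sqrt (τZ / τU)) • (1 - φU • Λ)⁻¹
      = β' • (1 : Matrix (Fin n) (Fin n) ℝ) +
        (ρ' * Real.sqrt (τZ' / τU')) • (1 - φU' • Λ)⁻¹)
    (hb : τU⁻¹ • (1 - φU • Λ)⁻¹ + τε⁻¹ • (Γᵀ * Matrix.diagonal d * Γ)
      = τU'⁻¹ • (1 - φU' • Λ)⁻¹ + τε'⁻¹ • (Γᵀ * Matrix.diagonal d * Γ))
    (hc : τZ • ((1 : Matrix (Fin n) (Fin n) ℝ) - φZ • Λ - (ρ ^ 2) • (1 - φU • Λ)⁻¹)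
      = τZ' • ((1 : Matrix (Fin n) (Fin n) ℝ) - φZ' • Λ - (ρ' ^ 2) • (1 - φU' • Λ)⁻¹)) :
    β' = β ∧ τU' = τU ∧ φU' = φU ∧ τZ' = τZ ∧ φZ' = φZ ∧ ρ' = ρ ∧ τε' = τε := by
  have hn0 : n ≠ 0 := by lia
  set S := CAR.normalized W d with hSdef
  have hspec' : S = Γ * Λ * Γᵀ := hspec
  have hS0 : ∀ i, S i i = 0 := fun i => by
    rw [hSdef, CAR.normalized_apply, hWdiag]; simp
  have hSne : S ≠ 0 := CAR.normalized_ne_zero hn0 hd hdpos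
  have conj : ∀ A B : Matrix (Fin n) (Fin n) ℝ,
      Γ * A * Γᵀ * (Γ * B * Γᵀ) = Γ * (A * B) * Γᵀ := by
    intro A B
    rw [mul_assoc (Γ * A), ← mul_assoc Γᵀ, ← mul_assoc Γᵀ, hΓ', one_mul]
    simp only [mul_assoc]
  have pencil : ∀ φ : ℝ, 1 - φ • S = Γ * (1 - φ • Λ) * Γᵀ := by
    intro φ
    rw [mul_sub, sub_mul, mul_one, hΓ, hspec', mul_smul_comm, smul_mul_assoc]
  have inv : ∀ φ : ℝ, (1 - φ • Λ).PosDef →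
      (1 - φ • S) * (Γ * (1 - φ • Λ)⁻¹ * Γᵀ) = 1 ∧
      (Γ * (1 - φ • Λ)⁻¹ * Γᵀ) * (1 - φ • S) = 1 := by
    intro φ h
    have hu := (Matrix.isUnit_iff_isUnit_det _).1 h.isUnit
    rw [pencil, conj, conj, Matrix.mul_nonsing_inv _ hu, Matrix.nonsing_inv_mul _ hu, mul_one, hΓ]
    exact ⟨rfl, rfl⟩
  obtain ⟨hR, hR2⟩ := inv φU hpd
  obtain ⟨hR', hR2'⟩ := inv φU' hpd'
  have hD : Γ * (Γᵀ * Matrix.diagonal d * Γ) * Γᵀ = Matrix.diagonal d := by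
    calc _ = (Γ * Γᵀ) * Matrix.diagonal d * (Γ * Γᵀ) := by simp only [mul_assoc]
      _ = _ := by rw [hΓ, one_mul, mul_one]
  replace ha := congrArg (fun M => Γ * M * Γᵀ) ha
  replace hb := congrArg (fun M => Γ * M * Γᵀ) hb
  replace hc := congrArg (fun M => Γ * M * Γᵀ) hc
  simp only [mul_add, add_mul, mul_sub, sub_mul, mul_smul_comm, smul_mul_assoc, mul_one, hΓ, hD,
    ← hspec'] at ha hb hc
  set R := Γ * (1 - φU • Λ)⁻¹ * Γᵀ
  set R' := Γ * (1 - φU' • Λ)⁻¹ * Γᵀ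
  have hu : τU⁻¹ ≠ 0 := inv_ne_zero hτU.ne'
  have hu' : τU'⁻¹ ≠ 0 := inv_ne_zero hτU'.ne'
  have hε : τε⁻¹ - τε'⁻¹ = 0 := by
    by_contra hne
    have hD' : Matrix.diagonal d =
        (τε⁻¹ - τε'⁻¹)⁻¹ • (τU'⁻¹ • R' - τU⁻¹ • R) := by
      rw [eq_inv_smul_iff₀ hne, sub_smul, sub_eq_sub_iff_add_eq_add, add_comm, hb, add_comm]
    have hcomm : Commute S (Matrix.diagonal d) := by
      rw [hD']
      exact (((CAR.commute_inverse hR' hR2').smul_right _).sub_right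
        ((CAR.commute_inverse hR hR2).smul_right _)).smul_right _
    have hdconst := CAR.eq_of_commute_diagonal hdpos hWconn hcomm
    rcases hEigOrD with ⟨a, b, c, hab, hac, hbc, hva, hvb, hvc⟩ | ⟨i, j, hij⟩
    · let k : Fin n := ⟨0, by lia⟩
      obtain ⟨δ, hδ⟩ : ∃ δ, δ = d k := ⟨_, rfl⟩
      have hdδ : ∀ i, d i = δ := fun i => (hdconst i k).trans hδ.symm
      have hδpos : 0 < δ := hδ ▸ hdpos k
      have hSW : S = δ⁻¹ • W := CAR.normalized_const W hδpos hdδ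
      have eig : ∀ x : ℝ, (∃ v : Fin n → ℝ, v ≠ 0 ∧ W.mulVec v = x • v) →
          ∃ v : Fin n → ℝ, v ≠ 0 ∧ S.mulVec v = (δ⁻¹ * x) • v := by
        rintro x ⟨v, hv, hx⟩
        exact ⟨v, hv, by rw [hSW, Matrix.smul_mulVec, hx, smul_smul]⟩
      have hinj : ∀ {x y : ℝ}, x ≠ y → δ⁻¹ * x ≠ δ⁻¹ * y := fun h =>
        (mul_right_injective₀ (inv_ne_zero hδpos.ne')).ne h
      have hDδ : Matrix.diagonal d = δ • (1 : Matrix (Fin n) (Fin n) ℝ) := by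
        rw [show d = fun _ => δ from funext hdδ, Matrix.smul_one_eq_diagonal]
      rw [hDδ] at hb
      have h1 := congrArg (fun M => (1 - φU' • S) * M * (1 - φU • S)) hb
      simp only [mul_add, add_mul, mul_smul_comm, smul_mul_assoc, hR', mul_one, one_mul] at h1
      rw [mul_assoc _ R, hR2, mul_one] at h1
      have h2 : (τU⁻¹ - τU'⁻¹ + (τε⁻¹ - τε'⁻¹) * δ) • (1 : Matrix (Fin n) (Fin n) ℝ)
          + (τU'⁻¹ * φU - τU⁻¹ * φU' - (τε⁻¹ - τε'⁻¹) * δ * (φU + φU')) • S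
          + ((τε⁻¹ - τε'⁻¹) * δ * (φU * φU')) • (S * S) = 0 := by
        rw [← sub_eq_zero] at h1
        rw [← h1]
        simp only [mul_sub, sub_mul, mul_smul_comm, smul_mul_assoc, mul_one, one_mul]
        module
      obtain ⟨e0, e1, e2⟩ := CAR.quadratic_coeffs_eq_zero_of_eigenvalues h2 (hinj hab) (hinj hac)
        (hinj hbc) (eig a hva) (eig b hvb) (eig c hvc)
      have hφ' : φU' = 0 := by simpa [hne, hδpos.ne', hφU] using e2
      subst hφ'
      have e3 : τU'⁻¹ - (τε⁻¹ - τε'⁻¹) * δ = 0 :=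
        mul_right_cancel₀ hφU (by linear_combination e1)
      exact hu (by linear_combination e0 + e3)
    · exact hij (hdconst i j)
  have hτε_eq : τε' = τε := (inv_injective (sub_eq_zero.1 hε)).symm
  subst hτε_eq
  obtain ⟨h1, rfl⟩ := CAR.params_eq_of_smul_inverse_eq hn0 hS0 hSne hu hR2 hR'
    (add_right_cancel hb)
  have hτU_eq : τU' = τU := inv_injective h1
  subst hτU_eq
  replace ha := congrArg (fun M => M * (1 - φU' • S)) ha
  simp only [add_mul, smul_mul_assoc, hR2, hR2', one_mul] at ha
  have ha' : (β - β' + (ρ * √(τZ / τU') - ρ' * √(τZ' / τU'))) • (1 : Matrix (Fin n) (Fin n) ℝ)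
      = ((β - β') * φU') • S := by
    rw [← sub_eq_zero] at ha ⊢
    rw [← ha]
    module
  obtain ⟨a0, a1⟩ := CAR.eq_zero_of_smul_one_eq_smul hn0 hS0 hSne ha'
  have hβ : β - β' = 0 := (mul_eq_zero.1 a1).resolve_right hφU
  have hκ : ρ * √(τZ / τU') = ρ' * √(τZ' / τU') := by linear_combination a0 - hβ
  have hκ2 : τZ * ρ ^ 2 = τZ' * ρ' ^ 2 := by
    have h2 := congrArg (fun x => x ^ 2) hκ
    simp only [mul_pow] at h2
    rw [Real.sq_sqrt (by positivity), Real.sq_sqrt (by positivity)] at h2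
    field_simp at h2
    linear_combination h2
  have hc' : (τZ - τZ') • (1 : Matrix (Fin n) (Fin n) ℝ) = (τZ * φZ - τZ' * φZ') • S := by
    simp only [smul_sub, smul_smul, hκ2] at hc
    rw [← sub_eq_zero] at hc ⊢
    rw [← hc]
    module
  obtain ⟨c0, c1⟩ := CAR.eq_zero_of_smul_one_eq_smul hn0 hS0 hSne hc'
  have hτZ_eq : τZ' = τZ := by linarith
  subst hτZ_eq
  refine ⟨by linarith, rfl, rfl, rfl, ?_, ?_, rfl⟩
  · exact mul_left_cancel₀ hτZ.ne' (by linarith)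
  · exact (mul_right_cancel₀ (Real.sqrt_pos.2 (div_pos hτZ hτU)).ne' hκ).symm
end

section
/- Let n ≥ 3 and let ω_1, …, ω_n be nonnegative reals taking at least three distinct values. Let (β, σ_Z, λ_Z, σ_U, λ_U, ρ, λ_UZ, σ_ε²) and (β̃, σ̃_Z, λ̃_Z, σ̃_U, λ̃_U, ρ̃, λ̃_UZ, σ̃_ε²) satisfy σ_Z, σ̃_Z, σ_U, σ̃_U > 0, λ_Z, λ̃_Z, λ_U, λ̃_U, λ_UZ, λ̃_UZ ∈ [0,1), and ρ, ρ̃ ∈ [−1,1]. Assume that for every i = 1, …, n: (a) σ_Z²/(1−λ_Z+λ_Z ω_i) = σ̃_Z²/(1−λ̃_Z+λ̃_Z ω_i); (b) β + (ρσ_U/σ_Z)·(1−λ_Z+λ_Z ω_i)/(1−λ_UZ+λ_UZ ω_i) = β̃ + (ρ̃σ̃_U/σ̃_Z)·(1−λ̃_Z+λ̃_Z ω_i)/(1−λ̃_UZ+λ̃_UZ ω_i); (c) σ_U²/(1−λ_U+λ_U ω_i) + σ_ε² − (ρσ_U)²·(1−λ_Z+λ_Z ω_i)/(1−λ_UZ+λ_UZ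 ω_i)² = σ̃_U²/(1−λ̃_U+λ̃_U ω_i) + σ̃_ε² − (ρ̃σ̃_U)²·(1−λ̃_Z+λ̃_Z ω_i)/(1−λ̃_UZ+λ̃_UZ ω_i)². If ρ ≠ 0 and λ_UZ ≠ λ_Z, then β̃ = β, σ̃_Z = σ_Z, λ̃_Z = λ_Z, λ̃_UZ = λ_UZ, and ρ̃σ̃_U = ρσ_U; if in addition λ_U ≠ 0, then also λ̃_U = λ_U, σ̃_U = σ_U, ρ̃ = ρ, and σ̃_ε² = σ_ε². -/
/-- A real polynomial of degree at most two with three distinct roots vanishes identically. -/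
theorem quadratic_coeffs_eq_zero {a b c x y z : ℝ} (hxy : x ≠ y) (hxz : x ≠ z) (hyz : y ≠ z)
    (hx : a + b * x + c * x ^ 2 = 0) (hy : a + b * y + c * y ^ 2 = 0)
    (hz : a + b * z + c * z ^ 2 = 0) : a = 0 ∧ b = 0 ∧ c = 0 := by
  have hby : b + c * (x + y) = 0 :=
    mul_left_cancel₀ (sub_ne_zero.mpr hxy) (by linear_combination hx - hy)
  have hbz : b + c * (x + z) = 0 :=
    mul_left_cancel₀ (sub_ne_zero.mpr hxz) (by linear_combination hx - hz)
  have hc : c = 0 := mul_left_cancel₀ (sub_ne_zero.mpr hyz) (by linear_combination hby - hbz)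
  have hb : b = 0 := by simpa [hc] using hby
  exact ⟨by simpa [hb, hc] using hx, hb, hc⟩

theorem leroux_denom_pos {l w : ℝ} (hl : l ∈ Set.Ico (0 : ℝ) 1) (hw : 0 ≤ w) :
    0 < 1 - l + l * w := by
  have := mul_nonneg hl.1 hw
  linarith [hl.2]

/-- The parameters of a Leroux variance spectrum are determined by its values at two points. -/
theorem leroux_spectrum_injective {s s' l l' x y : ℝ} (hs : s ≠ 0)
    (hl : l ∈ Set.Ico (0 : ℝ) 1) (hl' : l' ∈ Set.Ico (0 : ℝ) 1)
    (hx : 0 ≤ x) (hy : 0 ≤ y) (hxy : x ≠ y)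
    (h : ∀ w ∈ ({x, y} : Set ℝ), s / (1 - l + l * w) = s' / (1 - l' + l' * w)) :
    s' = s ∧ l' = l := by
  have h₁ := h x (by simp)
  have h₂ := h y (by simp)
  rw [div_eq_div_iff (leroux_denom_pos hl hx).ne' (leroux_denom_pos hl' hx).ne'] at h₁
  rw [div_eq_div_iff (leroux_denom_pos hl hy).ne' (leroux_denom_pos hl' hy).ne'] at h₂
  have hlin : s * l' = s' * l :=
    mul_left_cancel₀ (sub_ne_zero.mpr hxy) (by linear_combination h₁ - h₂)
  have hss : s' = s := by linear_combination (x - 1) * hlin - h₁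
  subst hss
  exact ⟨rfl, mul_left_cancel₀ hs hlin⟩

/-- An affine function of a non-constant ratio of Leroux denominators with known numerator
determines its parameters from three points. -/
theorem leroux_ratio_injective {b b' c c' l u u' x y z : ℝ} (hc : c ≠ 0) (hul : u ≠ l)
    (hu : u ∈ Set.Ico (0 : ℝ) 1) (hu' : u' ∈ Set.Ico (0 : ℝ) 1)
    (hx : 0 ≤ x) (hy : 0 ≤ y) (hz : 0 ≤ z) (hxy : x ≠ y) (hxz : x ≠ z) (hyz : y ≠ z)
    (h : ∀ w ∈ ({x, y, z} : Set ℝ), b + c * ((1 - l + l * w) / (1 - u + u * w))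
      = b' + c' * ((1 - l + l * w) / (1 - u' + u' * w))) :
    b' = b ∧ c' = c ∧ u' = u := by
  have key : ∀ w ∈ ({x, y, z} : Set ℝ), 0 ≤ w →
      (b' - b + c' - c) + ((b' - b) * (u + u') + c' * (l + u) - c * (l + u')) * (w - 1)
        + ((b' - b) * u * u' + c' * l * u - c * l * u') * (w - 1) ^ 2 = 0 := by
    intro w hw hw0
    have h₁ := h w hw
    have hd := (leroux_denom_pos hu hw0).ne'
    have hd' := (leroux_denom_pos hu' hw0).ne'
    rw [← mul_div_assoc, ← mul_div_assoc, add_div' _ _ _ hd, add_div' _ _ _ hd',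
      div_eq_div_iff hd hd'] at h₁
    linear_combination -h₁
  obtain ⟨h₀, h₁, h₂⟩ := quadratic_coeffs_eq_zero
    (sub_left_injective.ne hxy) (sub_left_injective.ne hxz) (sub_left_injective.ne hyz)
    (key x (by simp) hx) (key y (by simp) hy) (key z (by simp) hz)
  have huu : u' = u := by
    have : c * (u - l) * (u' - u) = 0 := by
      linear_combination h₂ - u * h₁ + u ^ 2 * h₀
    have := (mul_eq_zero.mp this).resolve_left (mul_ne_zero hc (sub_ne_zero.mpr hul))
    linarith
  subst huu
  have hcc : c' = c :=
    mul_left_cancel₀ (sub_ne_zero.mpr hul) (by linear_combination 2 * u' * h₀ - h₁)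
  exact ⟨by linarith, hcc, rfl⟩

/-- A Leroux variance spectrum with nonzero dependence parameter plus a nugget determines its
parameters from three points. -/
theorem leroux_nugget_injective {s s' l l' e e' x y z : ℝ} (hs : s ≠ 0) (hl0 : l ≠ 0)
    (hl : l ∈ Set.Ico (0 : ℝ) 1) (hl' : l' ∈ Set.Ico (0 : ℝ) 1)
    (hx : 0 ≤ x) (hy : 0 ≤ y) (hz : 0 ≤ z) (hxy : x ≠ y) (hxz : x ≠ z) (hyz : y ≠ z)
    (h : ∀ w ∈ ({x, y, z} : Set ℝ), s / (1 - l + l * w) + e = s' / (1 - l' + l' * w) + e') :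
    s' = s ∧ l' = l ∧ e' = e := by
  have key : ∀ w ∈ ({x, y, z} : Set ℝ), 0 ≤ w →
      (s - s' + (e - e')) + (s * l' - s' * l + (e - e') * (l + l')) * (w - 1)
        + ((e - e') * l * l') * (w - 1) ^ 2 = 0 := by
    intro w hw hw0
    have h₁ := h w hw
    have hd := (leroux_denom_pos hl hw0).ne'
    have hd' := (leroux_denom_pos hl' hw0).ne'
    rw [div_add' _ _ _ hd, div_add' _ _ _ hd', div_eq_div_iff hd hd'] at h₁
    linear_combination h₁
  obtain ⟨h₀, h₁, h₂⟩ := quadratic_coeffs_eq_zero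
    (sub_left_injective.ne hxy) (sub_left_injective.ne hxz) (sub_left_injective.ne hyz)
    (key x (by simp) hx) (key y (by simp) hy) (key z (by simp) hz)
  have hsl : s' * l' = s * l := by linear_combination h₁ - (l + l') * h₀
  have hl'0 : l' ≠ 0 := right_ne_zero_of_mul (hsl ▸ mul_ne_zero hs hl0)
  have he : e' = e := by
    have := (mul_eq_zero.mp ((mul_eq_zero.mp h₂).resolve_right hl'0)).resolve_right hl0
    linarith
  have hss : s' = s := by linarith
  subst hss
  exact ⟨rfl, mul_left_cancel₀ hs hsl, he⟩


/-- Theorem 2(i) (non-parsimonious Leroux CAR model, spectral form): if `ρ ≠ 0`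
and `λ_UZ ≠ λ_Z`, then `β, σ_Z, λ_Z, λ_UZ` and `ρσ_U` are identified; if in
addition `λ_U ≠ 0`, all remaining parameters are identified. -/
theorem lcar_flex_identifiability_case1 {n : ℕ} (hn : 3 ≤ n)
    (ω : Fin n → ℝ) (hω : ∀ i, 0 ≤ ω i)
    (hdist : ∃ i j k : Fin n, ω i ≠ ω j ∧ ω i ≠ ω k ∧ ω j ≠ ω k)
    (β σZ lamZ σU lamU ρ lamUZ σε2 : ℝ)
    (β' σZ' lamZ' σU' lamU' ρ' lamUZ' σε2' : ℝ)
    (hσZ : 0 < σZ) (hσZ' : 0 < σZ') (hσU : 0 < σU) (hσU' : 0 < σU')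
    (hlamZ : lamZ ∈ Set.Ico (0 : ℝ) 1) (hlamZ' : lamZ' ∈ Set.Ico (0 : ℝ) 1)
    (hlamU : lamU ∈ Set.Ico (0 : ℝ) 1) (hlamU' : lamU' ∈ Set.Ico (0 : ℝ) 1)
    (hlamUZ : lamUZ ∈ Set.Ico (0 : ℝ) 1) (hlamUZ' : lamUZ' ∈ Set.Ico (0 : ℝ) 1)
    (hρ : ρ ∈ Set.Icc (-1 : ℝ) 1) (hρ' : ρ' ∈ Set.Icc (-1 : ℝ) 1)
    (ha : ∀ i, σZ ^ 2 / (1 - lamZ + lamZ * ω i) = σZ' ^ 2 / (1 - lamZ' + lamZ' * ω i))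
    (hb : ∀ i, β + (ρ * σU / σZ) * ((1 - lamZ + lamZ * ω i) / (1 - lamUZ + lamUZ * ω i))
      = β' + (ρ' * σU' / σZ') * ((1 - lamZ' + lamZ' * ω i) / (1 - lamUZ' + lamUZ' * ω i)))
    (hc : ∀ i, σU ^ 2 / (1 - lamU + lamU * ω i) + σε2
        - (ρ * σU) ^ 2 * ((1 - lamZ + lamZ * ω i) / (1 - lamUZ + lamUZ * ω i) ^ 2)
      = σU' ^ 2 / (1 - lamU' + lamU' * ω i) + σε2'
        - (ρ' * σU') ^ 2 * ((1 - lamZ' + lamZ' * ω i) / (1 - lamUZ' + lamUZ' * ω i) ^ 2))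
    (hρ0 : ρ ≠ 0) (hUZ : lamUZ ≠ lamZ) :
    (β' = β ∧ σZ' = σZ ∧ lamZ' = lamZ ∧ lamUZ' = lamUZ ∧ ρ' * σU' = ρ * σU) ∧
    (lamU ≠ 0 → lamU' = lamU ∧ σU' = σU ∧ ρ' = ρ ∧ σε2' = σε2) := by
  obtain ⟨i, j, k, hij, hik, hjk⟩ := hdist
  obtain ⟨hs, rfl⟩ := leroux_spectrum_injective (pow_ne_zero 2 hσZ.ne') hlamZ hlamZ'
    (hω i) (hω j) hij (by rintro w (rfl | rfl) <;> exact ha _)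
  obtain rfl : σZ' = σZ := (pow_left_inj₀ hσZ'.le hσZ.le two_ne_zero).mp hs
  obtain ⟨hβ, hr, rfl⟩ := leroux_ratio_injective
    (div_ne_zero (mul_ne_zero hρ0 hσU.ne') hσZ.ne') hUZ hlamUZ hlamUZ'
    (hω i) (hω j) (hω k) hij hik hjk (by rintro w (rfl | rfl | rfl) <;> exact hb _)
  have hρσ : ρ' * σU' = ρ * σU := (div_left_inj' hσZ.ne').mp hr
  refine ⟨⟨hβ, rfl, rfl, rfl, hρσ⟩, fun hlamU0 => ?_⟩
  simp only [hρσ, sub_left_inj] at hc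
  obtain ⟨hsU, hl, he⟩ := leroux_nugget_injective (pow_ne_zero 2 hσU.ne') hlamU0 hlamU hlamU'
    (hω i) (hω j) (hω k) hij hik hjk (by rintro w (rfl | rfl | rfl) <;> exact hc _)
  obtain rfl : σU' = σU := (pow_left_inj₀ hσU'.le hσU.le two_ne_zero).mp hsU
  exact ⟨hl, rfl, mul_right_cancel₀ hσU.ne' hρσ, he⟩
end

section
/- Let n ≥ 4 and let ω_1, …, ω_n be nonnegative reals taking at least four distinct values. Let (β, σ_Z, λ_Z, σ_U, λ_U, ρ, λ_UZ, σ_ε²) and (β̃, σ̃_Z, λ̃_Z, σ̃_U, λ̃_U, ρ̃, λ̃_UZ, σ̃_ε²) satisfy σ_Z, σ̃_Z, σ_U, σ̃_U > 0, λ_Z, λ̃_Z, λ_U, λ̃_U, λ_UZ, λ̃_UZ ∈ [0,1), and ρ, ρ̃ ∈ [−1,1]. Assume that for every i = 1, …, n equations (a), (b), (c) hold: (a) σ_Z²/(1−λ_Z+λ_Z ω_i) = σ̃_Z²/(1−λ̃_Z+λ̃_Z ω_i); (b) β + (ρσ_U/σ_Z)·(1−λ_Z+λ_Z ω_i)/(1−λ_UZ+λ_UZ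 ω_i) = β̃ + (ρ̃σ̃_U/σ̃_Z)·(1−λ̃_Z+λ̃_Z ω_i)/(1−λ̃_UZ+λ̃_UZ ω_i); (c) σ_U²/(1−λ_U+λ_U ω_i) + σ_ε² − (ρσ_U)²·(1−λ_Z+λ_Z ω_i)/(1−λ_UZ+λ_UZ ω_i)² = σ̃_U²/(1−λ̃_U+λ̃_U ω_i) + σ̃_ε² − (ρ̃σ̃_U)²·(1−λ̃_Z+λ̃_Z ω_i)/(1−λ̃_UZ+λ̃_UZ ω_i)². If ρ = 0, λ_U ≠ λ_Z, λ_Z ≠ 0, and λ_U ≠ 0, then β̃ = β, σ̃_Z = σ_Z, λ̃_Z = λ_Z, ρ̃ = 0, λ̃_U = λ_U, σ̃_U = σ_U, and σ̃_ε² = σ_ε². -/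
open Polynomial

/-- If two affine functions of the form `s * (1 - l + l * x)` agree at two points, then they have
the same scale, and the same `l` unless the scale vanishes. -/
theorem eq_and_mul_eq_of_affine_eq {s t l m x y : ℝ} (hxy : x ≠ y)
    (hx : s * (1 - l + l * x) = t * (1 - m + m * x))
    (hy : s * (1 - l + l * y) = t * (1 - m + m * y)) : s = t ∧ s * l = s * m := by
  have hsl : s * l = t * m :=
    mul_left_cancel₀ (sub_ne_zero.2 hxy) (by linear_combination hx - hy)
  have hst : s = t := by linear_combination hx + (1 - x) * hsl
  exact ⟨hst, by rw [hsl, hst]⟩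

theorem one_sub_add_mul_pos {l x : ℝ} (hl : l ∈ Set.Ico (0 : ℝ) 1) (hx : 0 ≤ x) :
    0 < 1 - l + l * x := by
  have := mul_nonneg hl.1 hx
  linarith [hl.2]

/-- The zero of `1 - l + l * x` determines `l`. -/
theorem eq_of_one_sub_add_mul_eq_zero {l m x : ℝ} (hl : 1 - l + l * x = 0)
    (hm : 1 - m + m * x = 0) : m = l := by
  linear_combination m * hl - l * hm

theorem exists_one_sub_add_mul_eq_zero {l : ℝ} (hl : l ≠ 0) : ∃ x, 1 - l + l * x = 0 :=
  ⟨(l - 1) / l, by field_simp; ring⟩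

/-- Theorem 2(ii) (non-parsimonious Leroux CAR model, spectral form): if `ρ = 0`,
`λ_U ≠ λ_Z`, `λ_Z ≠ 0` and `λ_U ≠ 0`, then all parameters except `λ_UZ` are
identified (and the alternative correlation must also vanish). -/
theorem lcar_flex_identifiability_case2 {n : ℕ} (hn : 4 ≤ n)
    (ω : Fin n → ℝ) (hω : ∀ i, 0 ≤ ω i)
    (hdist : ∃ i j k l : Fin n, ω i ≠ ω j ∧ ω i ≠ ω k ∧ ω i ≠ ω l ∧
      ω j ≠ ω k ∧ ω j ≠ ω l ∧ ω k ≠ ω l)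
    (β σZ lamZ σU lamU ρ lamUZ σε2 : ℝ)
    (β' σZ' lamZ' σU' lamU' ρ' lamUZ' σε2' : ℝ)
    (hσZ : 0 < σZ) (hσZ' : 0 < σZ') (hσU : 0 < σU) (hσU' : 0 < σU')
    (hlamZ : lamZ ∈ Set.Ico (0 : ℝ) 1) (hlamZ' : lamZ' ∈ Set.Ico (0 : ℝ) 1)
    (hlamU : lamU ∈ Set.Ico (0 : ℝ) 1) (hlamU' : lamU' ∈ Set.Ico (0 : ℝ) 1)
    (hlamUZ : lamUZ ∈ Set.Ico (0 : ℝ) 1) (hlamUZ' : lamUZ' ∈ Set.Ico (0 : ℝ) 1)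
    (hρ : ρ ∈ Set.Icc (-1 : ℝ) 1) (hρ' : ρ' ∈ Set.Icc (-1 : ℝ) 1)
    (ha : ∀ i, σZ ^ 2 / (1 - lamZ + lamZ * ω i) = σZ' ^ 2 / (1 - lamZ' + lamZ' * ω i))
    (hb : ∀ i, β + (ρ * σU / σZ) * ((1 - lamZ + lamZ * ω i) / (1 - lamUZ + lamUZ * ω i))
      = β' + (ρ' * σU' / σZ') * ((1 - lamZ' + lamZ' * ω i) / (1 - lamUZ' + lamUZ' * ω i)))
    (hc : ∀ i, σU ^ 2 / (1 - lamU + lamU * ω i) + σε2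
        - (ρ * σU) ^ 2 * ((1 - lamZ + lamZ * ω i) / (1 - lamUZ + lamUZ * ω i) ^ 2)
      = σU' ^ 2 / (1 - lamU' + lamU' * ω i) + σε2'
        - (ρ' * σU') ^ 2 * ((1 - lamZ' + lamZ' * ω i) / (1 - lamUZ' + lamUZ' * ω i) ^ 2))
    (hρ0 : ρ = 0) (hUZne : lamU ≠ lamZ) (hZ0 : lamZ ≠ 0) (hU0 : lamU ≠ 0) :
    β' = β ∧ σZ' = σZ ∧ lamZ' = lamZ ∧ ρ' = 0 ∧ lamU' = lamU ∧ σU' = σU ∧ σε2' = σε2 := by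
  subst hρ0
  obtain ⟨i, j, k, l, hij, hik, hil, hjk, hjl, hkl⟩ := hdist
  have pos {m : ℝ} (hm : m ∈ Set.Ico (0 : ℝ) 1) (p : Fin n) : 1 - m + m * ω p ≠ 0 :=
    (one_sub_add_mul_pos hm (hω p)).ne'
  have ha' (p : Fin n) :
      σZ ^ 2 * (1 - lamZ' + lamZ' * ω p) = σZ' ^ 2 * (1 - lamZ + lamZ * ω p) :=
    (div_eq_div_iff (pos hlamZ p) (pos hlamZ' p)).1 (ha p)
  obtain ⟨hσ, hlam⟩ := eq_and_mul_eq_of_affine_eq hij (ha' i) (ha' j)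
  obtain rfl : lamZ' = lamZ := mul_left_cancel₀ (by positivity) hlam
  obtain rfl : σZ = σZ' := (sq_eq_sq₀ hσZ.le hσZ'.le).1 hσ
  have hb' (p : Fin n) : (β - β') * (1 - lamUZ' + lamUZ' * ω p) =
      ρ' * σU' / σZ * (1 - lamZ' + lamZ' * ω p) := by
    have h := hb p
    have h0 := pos hlamUZ' p
    generalize 1 - lamUZ' + lamUZ' * ω p = v at h h0 ⊢
    generalize ρ' * σU' / σZ = s at h ⊢
    simp only [zero_mul, zero_div, add_zero] at h
    rw [h]
    field_simp
    ring
  obtain ⟨hβ, hUZ⟩ := eq_and_mul_eq_of_affine_eq hij (hb' i) (hb' j)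
  have hcard : 3 < (Finset.univ.image ω).card := by
    calc 3 < ({ω i, ω j, ω k, ω l} : Finset ℝ).card := by simp [*]
      _ ≤ _ := Finset.card_le_card (by simp [Finset.insert_subset_iff])
  have vanish (q : ℝ[X]) (hq : q.natDegree ≤ 3) (h : ∀ p, q.eval (ω p) = 0) (x : ℝ) :
      q.eval x = 0 := by
    rw [eq_zero_of_natDegree_lt_card_of_eval_eq_zero' q _ (by simpa using h)
      (hq.trans_lt hcard), eval_zero]
  have hρ'0 : ρ' = 0 := by
    by_contra hne
    have hs : β - β' ≠ 0 := by rw [hβ]; positivity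
    obtain rfl : lamUZ' = lamZ' := mul_left_cancel₀ hs hUZ
    have hcubic (x : ℝ) :
        σU ^ 2 * (1 - lamU' + lamU' * x) * (1 - lamUZ' + lamUZ' * x)
        + (ρ' * σU') ^ 2 * (1 - lamU + lamU * x) * (1 - lamU' + lamU' * x)
        + (σε2 - σε2') * (1 - lamU + lamU * x) * (1 - lamU' + lamU' * x)
          * (1 - lamUZ' + lamUZ' * x)
        - σU' ^ 2 * (1 - lamU + lamU * x) * (1 - lamUZ' + lamUZ' * x) = 0 := by
      have h := vanish
        (C (σU ^ 2) * (C (1 - lamU') + C lamU' * X) * (C (1 - lamUZ') + C lamUZ' * X)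
          + C ((ρ' * σU') ^ 2) * (C (1 - lamU) + C lamU * X) * (C (1 - lamU') + C lamU' * X)
          + C (σε2 - σε2') * (C (1 - lamU) + C lamU * X) * (C (1 - lamU') + C lamU' * X)
            * (C (1 - lamUZ') + C lamUZ' * X)
          - C (σU' ^ 2) * (C (1 - lamU) + C lamU * X) * (C (1 - lamUZ') + C lamUZ' * X))
        (by compute_degree!) ?_ x
      · simpa using h
      intro p
      have h := hc p
      have hhu := pos hlamU p
      have hhv := pos hlamU' p
      have hhw := pos hlamUZ' p
      simp only [eval_add, eval_sub, eval_mul, eval_C, eval_X]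
      generalize 1 - lamU + lamU * ω p = u at h hhu ⊢
      generalize 1 - lamU' + lamU' * ω p = v at h hhv ⊢
      generalize 1 - lamUZ' + lamUZ' * ω p = w at h hhw ⊢
      simp only [zero_mul, ne_eq, OfNat.ofNat_ne_zero, not_false_eq_true, zero_pow, sub_zero] at h
      field_simp at h
      linear_combination h
    obtain ⟨x, hx⟩ := exists_one_sub_add_mul_eq_zero hU0
    obtain ⟨y, hy⟩ := exists_one_sub_add_mul_eq_zero hZ0
    have hx' : lamU' = lamU := by
      have h := hcubic x
      simp only [hx, mul_zero, zero_mul, add_zero, sub_zero, mul_eq_zero, pow_eq_zero_iff,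
        hσU.ne', ne_eq, OfNat.ofNat_ne_zero, not_false_eq_true, false_or] at h
      exact h.elim (eq_of_one_sub_add_mul_eq_zero hx)
        fun h ↦ absurd (eq_of_one_sub_add_mul_eq_zero h hx) hUZne
    subst hx'
    have h := hcubic y
    simp only [hy, mul_zero, zero_add, add_zero, sub_zero, mul_eq_zero, pow_eq_zero_iff,
      hσU'.ne', hne, ne_eq, OfNat.ofNat_ne_zero, not_false_eq_true, false_or, or_self] at h
    exact hUZne (eq_of_one_sub_add_mul_eq_zero hy h)
  subst hρ'0
  have hβ' : β' = β := by linear_combination -hβ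
  have hquad (x : ℝ) :
      σU ^ 2 * (1 - lamU' + lamU' * x)
      + (σε2 - σε2') * (1 - lamU + lamU * x) * (1 - lamU' + lamU' * x)
      - σU' ^ 2 * (1 - lamU + lamU * x) = 0 := by
    have h := vanish (C (σU ^ 2) * (C (1 - lamU') + C lamU' * X)
        + C (σε2 - σε2') * (C (1 - lamU) + C lamU * X) * (C (1 - lamU') + C lamU' * X)
        - C (σU' ^ 2) * (C (1 - lamU) + C lamU * X)) (by compute_degree!) ?_ x
    · simpa using h
    intro p
    have h := hc p
    have hhu := pos hlamU p
    have hhv := pos hlamU' p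
    simp only [eval_add, eval_sub, eval_mul, eval_C, eval_X]
    generalize 1 - lamU + lamU * ω p = u at h hhu ⊢
    generalize 1 - lamU' + lamU' * ω p = v at h hhv ⊢
    simp only [zero_mul, ne_eq, OfNat.ofNat_ne_zero, not_false_eq_true, zero_pow, sub_zero] at h
    field_simp at h
    linear_combination h
  obtain ⟨x, hx⟩ := exists_one_sub_add_mul_eq_zero hU0
  obtain rfl : lamU' = lamU := by
    have h := hquad x
    simp only [hx, mul_zero, zero_mul, add_zero, sub_zero, mul_eq_zero, pow_eq_zero_iff,
      hσU.ne', ne_eq, OfNat.ofNat_ne_zero, not_false_eq_true, false_or] at h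
    exact eq_of_one_sub_add_mul_eq_zero hx h
  have hlin (p : Fin n) : σU ^ 2 - σU' ^ 2 + (σε2 - σε2') * (1 - lamU' + lamU' * ω p) = 0 :=
    mul_left_cancel₀ (pos hlamU p) (by linear_combination hquad (ω p))
  have hε : σε2 - σε2' = 0 :=
    mul_left_cancel₀ (mul_ne_zero hU0 (sub_ne_zero.2 hij))
      (by linear_combination hlin i - hlin j)
  have hσU2 : σU' ^ 2 = σU ^ 2 := by
    linear_combination -hlin i + (1 - lamU' + lamU' * ω i) * hε
  exact ⟨hβ', rfl, rfl, rfl, rfl, (sq_eq_sq₀ hσU'.le hσU.le).1 hσU2, by linear_combination -hε⟩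
end

section
/- Let n ≥ 3 and let ω_1, …, ω_n be nonnegative reals taking at least three distinct values, one of which equals 0. Let (β, σ_Z, λ_Z, σ_U, λ_U, ρ, σ_ε²) and (β̃, σ̃_Z, λ̃_Z, σ̃_U, λ̃_U, ρ̃, σ̃_ε²) satisfy σ_Z, σ̃_Z, σ_U, σ̃_U > 0, λ_Z, λ̃_Z, λ_U, λ̃_U ∈ [0,1), and ρ, ρ̃ ∈ [−1,1]. Assume that for every i = 1, …, n: (a) σ_Z²/(1−λ_Z+λ_Z ω_i) = σ̃_Z²/(1−λ̃_Z+λ̃_Z ω_i); (b) β + ρ(σ_U/σ_Z)·√((1−λ_Z+λ_Z ω_i)/(1−λ_U+λ_U ω_i)) = β̃ + ρ̃(σ̃_U/σ̃_Z)·√((1−λ̃_Z+λ̃_Z ω_i)/(1−λ̃_U+λ̃_U ω_i)); (c) (1−ρ²)σ_U²/(1−λ_U+λ_U ω_i) + σ_ε² = (1−ρ̃²)σ̃_U²/(1−λ̃_U+λ̃_U ω_i) + σ̃_ε². If λ_U ≠ λ_Z and ρ ≠ 0, then β̃ = β, σ̃_Z = σ_Z, λ̃_Z = λ_Z, λ̃_U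 = λ_U, and ρ̃σ̃_U = ρσ_U. -/
/-- The ratio of `√(1 + b x) (√(1 + b x) + √(1 + a x))` at a larger and at a smaller value of `b`
is strictly increasing in `x`. -/
theorem sqrt_mul_sqrt_add_sqrt_cross_lt {a b b' x y : ℝ} (ha : 0 ≤ a) (hb : 0 ≤ b) (hbb : b < b')
    (hx : 0 < x) (hxy : x < y) :
    √(1 + b' * x) * (√(1 + b' * x) + √(1 + a * x)) *
        (√(1 + b * y) * (√(1 + b * y) + √(1 + a * y))) <
      √(1 + b' * y) * (√(1 + b' * y) + √(1 + a * y)) *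
        (√(1 + b * x) * (√(1 + b * x) + √(1 + a * x))) := by
  have hy : 0 < y := hx.trans hxy
  have hb' : 0 ≤ b' := hb.trans hbb.le
  have hpos : ∀ {c z : ℝ}, 0 ≤ c → 0 < z → 0 < 1 + c * z := fun hc hz => by positivity
  have hscale : ∀ {c : ℝ}, 0 ≤ c → √x * √(1 + c * y) ≤ √y * √(1 + c * x) := fun hc => by
    rw [← Real.sqrt_mul hx.le, ← Real.sqrt_mul hy.le]
    exact Real.sqrt_le_sqrt (by linarith)
  have hcross : √(1 + b' * x) * √(1 + b * y) < √(1 + b' * y) * √(1 + b * x) := by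
    rw [← Real.sqrt_mul (hpos hb' hx).le, ← Real.sqrt_mul (hpos hb' hy).le]
    refine Real.sqrt_lt_sqrt (mul_pos (hpos hb' hx) (hpos hb hy)).le ?_
    nlinarith [mul_pos (sub_pos.2 hbb) (sub_pos.2 hxy)]
  have hs := hscale hb
  have hs' := hscale hb'
  have ht := hscale ha
  have sx := Real.sq_sqrt (hpos hb hx).le
  have sy := Real.sq_sqrt (hpos hb hy).le
  have sx' := Real.sq_sqrt (hpos hb' hx).le
  have sy' := Real.sq_sqrt (hpos hb' hy).le
  have rx := Real.sq_sqrt hx.le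
  have ry := Real.sq_sqrt hy.le
  have psx := Real.sqrt_pos.2 (hpos hb hx)
  have psy := Real.sqrt_pos.2 (hpos hb hy)
  have psx' := Real.sqrt_pos.2 (hpos hb' hx)
  have psy' := Real.sqrt_pos.2 (hpos hb' hy)
  have ptx := Real.sqrt_pos.2 (hpos ha hx)
  have pty := Real.sqrt_pos.2 (hpos ha hy)
  have prx := Real.sqrt_pos.2 hx
  have pry := Real.sqrt_pos.2 hy
  generalize √(1 + b * x) = s₁ at *
  generalize √(1 + b * y) = s₂ at *
  generalize √(1 + b' * x) = s₁' at *
  generalize √(1 + b' * y) = s₂' at *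
  generalize √(1 + a * x) = t₁ at *
  generalize √(1 + a * y) = t₂ at *
  generalize √x = r₁ at *
  generalize √y = r₂ at *
  have hprod : (r₁ * (s₂ + s₂')) * (r₁ * (s₂ + t₂)) ≤ (r₂ * (s₁ + s₁')) * (r₂ * (s₁ + t₁)) :=
    mul_le_mul (by linarith) (by linarith) (by positivity) (by positivity)
  have hdiff : (s₁' - s₁) * (s₂ + t₂) ≤ (s₂' - s₂) * (s₁ + t₁) := by
    refine le_of_mul_le_mul_left ?_ (mul_pos (add_pos psx psx') (add_pos psy psy'))
    calc (s₁ + s₁') * (s₂ + s₂') * ((s₁' - s₁) * (s₂ + t₂))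
        = (s₁' ^ 2 - s₁ ^ 2) * ((s₂ + s₂') * (s₂ + t₂)) := by ring
      _ = (b' - b) * ((r₁ * (s₂ + s₂')) * (r₁ * (s₂ + t₂))) := by
          rw [sx, sx', ← rx]; ring
      _ ≤ (b' - b) * ((r₂ * (s₁ + s₁')) * (r₂ * (s₁ + t₁))) :=
          mul_le_mul_of_nonneg_left hprod (sub_pos.2 hbb).le
      _ = (s₂' ^ 2 - s₂ ^ 2) * ((s₁ + s₁') * (s₁ + t₁)) := by
          rw [sy, sy', ← ry]; ring
      _ = (s₁ + s₁') * (s₂ + s₂') * ((s₂' - s₂) * (s₁ + t₁)) := by ring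
  calc s₁' * (s₁' + t₁) * (s₂ * (s₂ + t₂))
      = (s₁' * s₂) * ((s₁' + t₁) * (s₂ + t₂)) := by ring
    _ < (s₂' * s₁) * ((s₂' + t₂) * (s₁ + t₁)) :=
        mul_lt_mul hcross (by linarith) (by positivity) (by positivity)
    _ = s₂' * (s₂' + t₂) * (s₁ * (s₁ + t₁)) := by ring

theorem sqrt_div_sub_one {a b x : ℝ} (ha : 0 ≤ a) (hb : 0 ≤ b) (hx : 0 < x) :
    √((1 + a * x) / (1 + b * x)) - 1 =
      (a - b) * x / (√(1 + b * x) * (√(1 + b * x) + √(1 + a * x))) := by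
  have hp : 0 < 1 + a * x := by positivity
  have hq : 0 < 1 + b * x := by positivity
  have hs := Real.sqrt_pos.2 hq
  have ht := Real.sqrt_pos.2 hp
  rw [Real.sqrt_div hp.le, eq_div_iff (by positivity), sub_mul, div_mul_eq_mul_div,
    mul_left_comm, mul_div_cancel_left₀ _ hs.ne']
  linear_combination Real.sq_sqrt hp.le - Real.sq_sqrt hq.le

/-- An affine function of `√((1 + a x) / (1 + b x))` with nonzero slope and `b ≠ a` is determined
by its values at `0` and at two distinct positive points. -/
theorem affine_sqrt_div_injective {a b b' x y K K' β β' : ℝ} (ha : 0 ≤ a) (hb : 0 ≤ b)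
    (hb' : 0 ≤ b') (hx : 0 < x) (hxy : x < y) (hK : K ≠ 0) (hab : a ≠ b)
    (h0 : β + K = β' + K')
    (h : ∀ z ∈ ({x, y} : Set ℝ), β + K * √((1 + a * z) / (1 + b * z)) =
      β' + K' * √((1 + a * z) / (1 + b' * z))) :
    β' = β ∧ b' = b ∧ K' = K := by
  have hy := hx.trans hxy
  have hpos : ∀ {c z : ℝ}, 0 ≤ c → 0 < z →
      0 < √(1 + c * z) * (√(1 + c * z) + √(1 + a * z)) := fun hc hz => by positivity
  have key : ∀ z ∈ ({x, y} : Set ℝ), 0 < z →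
      K * (a - b) * (√(1 + b' * z) * (√(1 + b' * z) + √(1 + a * z))) =
        K' * (a - b') * (√(1 + b * z) * (√(1 + b * z) + √(1 + a * z))) := fun z hz hz0 => by
    have e : K * (√((1 + a * z) / (1 + b * z)) - 1) =
        K' * (√((1 + a * z) / (1 + b' * z)) - 1) := by linear_combination h z hz - h0
    rw [sqrt_div_sub_one ha hb hz0, sqrt_div_sub_one ha hb' hz0, mul_div_assoc', mul_div_assoc',
      div_eq_div_iff (hpos hb hz0).ne' (hpos hb' hz0).ne'] at e
    exact mul_left_cancel₀ hz0.ne' (by linear_combination e)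
  have kx := key x (by simp) hx
  have ky := key y (by simp) hy
  have hP : K * (a - b) ≠ 0 := mul_ne_zero hK (sub_ne_zero.2 hab)
  have hcross : √(1 + b' * x) * (√(1 + b' * x) + √(1 + a * x)) *
        (√(1 + b * y) * (√(1 + b * y) + √(1 + a * y))) =
      √(1 + b' * y) * (√(1 + b' * y) + √(1 + a * y)) *
        (√(1 + b * x) * (√(1 + b * x) + √(1 + a * x))) := by
    refine mul_left_cancel₀ hP ?_
    linear_combination √(1 + b * y) * (√(1 + b * y) + √(1 + a * y)) * kx -
      √(1 + b * x) * (√(1 + b * x) + √(1 + a * x)) * ky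
  obtain rfl : b' = b := by
    rcases lt_trichotomy b b' with hlt | heq | hlt
    · exact absurd hcross (sqrt_mul_sqrt_add_sqrt_cross_lt ha hb hlt hx hxy).ne
    · exact heq.symm
    · have := sqrt_mul_sqrt_add_sqrt_cross_lt ha hb' hlt hx hxy
      linarith
  have hKK : K' = K :=
    (mul_right_cancel₀ (sub_ne_zero.2 hab) (mul_right_cancel₀ (hpos hb hx).ne' kx)).symm
  exact ⟨by linarith, rfl, hKK⟩

theorem leroux_eq_mul {l : ℝ} (hl : l < 1) (x : ℝ) :
    1 - l + l * x = (1 - l) * (1 + l / (1 - l) * x) := by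
  have : 1 - l ≠ 0 := (sub_pos.2 hl).ne'
  field_simp

theorem leroux_odds_injective {l m : ℝ} (hl : l < 1) (hm : m < 1)
    (h : l / (1 - l) = m / (1 - m)) : l = m := by
  rw [div_eq_div_iff (sub_pos.2 hl).ne' (sub_pos.2 hm).ne'] at h
  linarith

/-- A Leroux spectral variance is determined by its values at `0` and at one positive point. -/
theorem leroux_variance_injective {σ σ' l l' x : ℝ} (hσ : 0 < σ) (hσ' : 0 < σ')
    (hl : l ∈ Set.Ico (0 : ℝ) 1) (hl' : l' ∈ Set.Ico (0 : ℝ) 1) (hx : 0 < x)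
    (h0 : σ ^ 2 / (1 - l) = σ' ^ 2 / (1 - l'))
    (h : σ ^ 2 / (1 - l + l * x) = σ' ^ 2 / (1 - l' + l' * x)) :
    σ' = σ ∧ l' = l := by
  have hd : 0 < 1 - l := sub_pos.2 hl.2
  have hd' : 0 < 1 - l' := sub_pos.2 hl'.2
  have hq : 0 < 1 + l / (1 - l) * x := by have := hl.1; positivity
  have hq' : 0 < 1 + l' / (1 - l') * x := by have := hl'.1; positivity
  rw [leroux_eq_mul hl.2, leroux_eq_mul hl'.2, ← div_div, ← div_div, ← h0,
    div_eq_div_iff hq.ne' hq'.ne', mul_right_inj' (by positivity), add_right_inj, mul_left_inj' hx.ne'] at h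
  obtain rfl := leroux_odds_injective hl'.2 hl.2 h
  rw [div_left_inj' hd.ne'] at h0
  exact ⟨((pow_left_inj₀ hσ.le hσ'.le two_ne_zero).1 h0).symm, rfl⟩


/-- Theorem 3(i) (parsimonious Leroux CAR model, spectral form): if `λ_U ≠ λ_Z`
and `ρ ≠ 0`, then `β, σ_Z, λ_Z, λ_U` and `ρσ_U` are identified. -/
theorem lcar_pars_identifiability_case1 {n : ℕ} (hn : 3 ≤ n)
    (ω : Fin n → ℝ) (hω : ∀ i, 0 ≤ ω i)
    (hdist : ∃ i j k : Fin n, ω i ≠ ω j ∧ ω i ≠ ω k ∧ ω j ≠ ω k)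
    (hzero : ∃ i, ω i = 0)
    (β σZ lamZ σU lamU ρ σε2 : ℝ)
    (β' σZ' lamZ' σU' lamU' ρ' σε2' : ℝ)
    (hσZ : 0 < σZ) (hσZ' : 0 < σZ') (hσU : 0 < σU) (hσU' : 0 < σU')
    (hlamZ : lamZ ∈ Set.Ico (0 : ℝ) 1) (hlamZ' : lamZ' ∈ Set.Ico (0 : ℝ) 1)
    (hlamU : lamU ∈ Set.Ico (0 : ℝ) 1) (hlamU' : lamU' ∈ Set.Ico (0 : ℝ) 1)
    (hρ : ρ ∈ Set.Icc (-1 : ℝ) 1) (hρ' : ρ' ∈ Set.Icc (-1 : ℝ) 1)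
    (ha : ∀ i, σZ ^ 2 / (1 - lamZ + lamZ * ω i) = σZ' ^ 2 / (1 - lamZ' + lamZ' * ω i))
    (hb : ∀ i, β + ρ * (σU / σZ) *
        Real.sqrt ((1 - lamZ + lamZ * ω i) / (1 - lamU + lamU * ω i))
      = β' + ρ' * (σU' / σZ') *
        Real.sqrt ((1 - lamZ' + lamZ' * ω i) / (1 - lamU' + lamU' * ω i)))
    (hc : ∀ i, (1 - ρ ^ 2) * σU ^ 2 / (1 - lamU + lamU * ω i) + σε2
      = (1 - ρ' ^ 2) * σU' ^ 2 / (1 - lamU' + lamU' * ω i) + σε2')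
    (hUZne : lamU ≠ lamZ) (hρ0 : ρ ≠ 0) :
    β' = β ∧ σZ' = σZ ∧ lamZ' = lamZ ∧ lamU' = lamU ∧ ρ' * σU' = ρ * σU := by
  obtain ⟨i₀, hi₀⟩ := hzero
  obtain ⟨i, j, hi, hij⟩ : ∃ i j, 0 < ω i ∧ ω i < ω j := by
    obtain ⟨i, j, k, hij, hik, hjk⟩ := hdist
    rcases lt_or_gt_of_ne hij with h₁ | h₁ <;> rcases lt_or_gt_of_ne hik with h₂ | h₂ <;>
      rcases lt_or_gt_of_ne hjk with h₃ | h₃ <;>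
      first
      | exact ⟨_, _, (hω _).trans_lt h₁, h₂⟩
      | exact ⟨_, _, (hω _).trans_lt h₁, h₃⟩
      | exact ⟨_, _, (hω _).trans_lt h₂, h₁⟩
      | exact ⟨_, _, (hω _).trans_lt h₂, h₃⟩
      | exact ⟨_, _, (hω _).trans_lt h₃, h₁⟩
      | exact ⟨_, _, (hω _).trans_lt h₃, h₂⟩
  obtain ⟨rfl, rfl⟩ := leroux_variance_injective hσZ hσZ' hlamZ hlamZ' hi
    (by simpa [hi₀] using ha i₀) (ha i)
  have dZ : 0 < 1 - lamZ' := sub_pos.2 hlamZ.2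
  have dU : 0 < 1 - lamU := sub_pos.2 hlamU.2
  have dU' : 0 < 1 - lamU' := sub_pos.2 hlamU'.2
  have hfac : ∀ {l : ℝ}, l < 1 → ∀ x : ℝ, √((1 - lamZ' + lamZ' * x) / (1 - l + l * x)) =
      √((1 - lamZ') / (1 - l)) *
        √((1 + lamZ' / (1 - lamZ') * x) / (1 + l / (1 - l) * x)) := fun {l} hl x => by
    rw [← Real.sqrt_mul (div_pos dZ (sub_pos.2 hl)).le, leroux_eq_mul hlamZ.2, leroux_eq_mul hl,
      mul_div_mul_comm]
  have hb' : ∀ i, β + ρ * (σU / σZ') * √((1 - lamZ') / (1 - lamU)) *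
        √((1 + lamZ' / (1 - lamZ') * ω i) / (1 + lamU / (1 - lamU) * ω i)) =
      β' + ρ' * (σU' / σZ') * √((1 - lamZ') / (1 - lamU')) *
        √((1 + lamZ' / (1 - lamZ') * ω i) / (1 + lamU' / (1 - lamU') * ω i)) := fun i => by
    linear_combination hb i - ρ * (σU / σZ') * hfac hlamU.2 (ω i) +
      ρ' * (σU' / σZ') * hfac hlamU'.2 (ω i)
  obtain ⟨hβ, hodds, hK⟩ := affine_sqrt_div_injective (div_nonneg hlamZ.1 dZ.le)
    (div_nonneg hlamU.1 dU.le) (div_nonneg hlamU'.1 dU'.le) hi hij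
    (mul_ne_zero (mul_ne_zero hρ0 (div_pos hσU hσZ).ne') (Real.sqrt_pos.2 (div_pos dZ dU)).ne')
    (fun h => hUZne (leroux_odds_injective hlamU.2 hlamZ.2 h.symm))
    (by simpa [hi₀] using hb' i₀)
    (by rintro z (rfl | rfl); exacts [hb' i, hb' j])
  obtain rfl := leroux_odds_injective hlamU'.2 hlamU.2 hodds
  refine ⟨hβ, rfl, rfl, rfl, ?_⟩
  have := mul_right_cancel₀ (Real.sqrt_pos.2 (div_pos dZ dU)).ne' hK
  rwa [← mul_div_assoc, ← mul_div_assoc, div_left_inj' hσZ.ne'] at this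
end

section
/- Let n ≥ 3 and let ω_1, …, ω_n be nonnegative reals taking at least three distinct values, one of which equals 0. Let (β, σ_Z, λ_Z, σ_U, λ_U, ρ, σ_ε²) and (β̃, σ̃_Z, λ̃_Z, σ̃_U, λ̃_U, ρ̃, σ̃_ε²) satisfy σ_Z, σ̃_Z, σ_U, σ̃_U > 0, λ_Z, λ̃_Z, λ_U, λ̃_U ∈ [0,1), and ρ, ρ̃ ∈ [−1,1]. Assume that for every i = 1, …, n: (a) σ_Z²/(1−λ_Z+λ_Z ω_i) = σ̃_Z²/(1−λ̃_Z+λ̃_Z ω_i); (b) β + ρ(σ_U/σ_Z)·√((1−λ_Z+λ_Z ω_i)/(1−λ_U+λ_U ω_i)) = β̃ + ρ̃(σ̃_U/σ̃_Z)·√((1−λ̃_Z+λ̃_Z ω_i)/(1−λ̃_U+λ̃_U ω_i)); (c) (1−ρ²)σ_U²/(1−λ_U+λ_U ω_i) + σ_ε² = (1−ρ̃²)σ̃_U²/(1−λ̃_U+λ̃_U ω_i) + σ̃_ε². If λ_U ≠ λ_Z and λ_U ≠ 0, then β̃ = β, σ̃_Z = σ_Z, λ̃_Z = λ_Z, λ̃_U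 = λ_U, σ̃_U = σ_U, ρ̃ = ρ, and σ̃_ε² = σ_ε². -/
/-- The Leroux precision `1 - lam + lam * x` is positive at nonnegative `x`. -/
lemma leroux_pos {lam x : ℝ} (h : lam ∈ Set.Ico (0 : ℝ) 1) (hx : 0 ≤ x) :
    0 < 1 - lam + lam * x := by
  have h1 : 0 < 1 - lam := sub_pos.mpr h.2
  have h2 : 0 ≤ lam * x := mul_nonneg h.1 hx
  linarith

/-- A Leroux variance is determined by its values at two points. -/
lemma leroux_variance_injective_s4 {c c' lam lam' x y : ℝ} (hc : c ≠ 0) (hxy : x ≠ y)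
    (px : 1 - lam + lam * x ≠ 0) (py : 1 - lam + lam * y ≠ 0)
    (px' : 1 - lam' + lam' * x ≠ 0) (py' : 1 - lam' + lam' * y ≠ 0)
    (hx : c / (1 - lam + lam * x) = c' / (1 - lam' + lam' * x))
    (hy : c / (1 - lam + lam * y) = c' / (1 - lam' + lam' * y)) :
    c' = c ∧ lam' = lam := by
  rw [div_eq_div_iff px px'] at hx
  rw [div_eq_div_iff py py'] at hy
  have h1 : c * lam' = c' * lam :=
    mul_right_cancel₀ (sub_ne_zero.mpr hxy) (by linear_combination hx - hy)
  have h2 : c' = c := by linear_combination (x - 1) * h1 - hx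
  subst h2
  exact ⟨rfl, mul_left_cancel₀ hc h1⟩

/-- Three values of a nonconstant Leroux variance plus a nugget determine its spatial parameter. -/
lemma leroux_param_eq_of_variance_add_const {c c' d d' lam lam' x y z : ℝ}
    (hc : c ≠ 0) (hlam : lam ≠ 0) (hxy : x ≠ y) (hxz : x ≠ z) (hyz : y ≠ z)
    (px : 1 - lam + lam * x ≠ 0) (py : 1 - lam + lam * y ≠ 0) (pz : 1 - lam + lam * z ≠ 0)
    (px' : 1 - lam' + lam' * x ≠ 0) (py' : 1 - lam' + lam' * y ≠ 0)
    (pz' : 1 - lam' + lam' * z ≠ 0)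
    (hx : c / (1 - lam + lam * x) + d = c' / (1 - lam' + lam' * x) + d')
    (hy : c / (1 - lam + lam * y) + d = c' / (1 - lam' + lam' * y) + d')
    (hz : c / (1 - lam + lam * z) + d = c' / (1 - lam' + lam' * z) + d') :
    lam' = lam := by
  have cleared : ∀ w, 1 - lam + lam * w ≠ 0 → 1 - lam' + lam' * w ≠ 0 →
      c / (1 - lam + lam * w) + d = c' / (1 - lam' + lam' * w) + d' →
      c * (1 - lam' + lam' * w) - c' * (1 - lam + lam * w)
        = (d' - d) * ((1 - lam + lam * w) * (1 - lam' + lam' * w)) := by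
    intro w p p' h
    rw [div_add' _ _ _ p, div_add' _ _ _ p', div_eq_div_iff p p'] at h
    linear_combination h
  have ex := cleared x px px' hx
  have ey := cleared y py py' hy
  have ez := cleared z pz pz' hz
  have hprod : (d' - d) * (lam * lam') = 0 := by
    have hV : (x - y) * (x - z) * (y - z) ≠ 0 :=
      mul_ne_zero (mul_ne_zero (sub_ne_zero.mpr hxy) (sub_ne_zero.mpr hxz)) (sub_ne_zero.mpr hyz)
    refine (mul_eq_zero.mp ?_).resolve_right hV
    linear_combination -(y - z) * ex + (x - z) * ey - (x - y) * ez
  rcases mul_eq_zero.mp hprod with hd | hl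
  · obtain rfl : d' = d := sub_eq_zero.mp hd
    exact (leroux_variance_injective_s4 hc hxy px py px' py' (add_right_cancel hx)
      (add_right_cancel hy)).2
  · obtain rfl : lam' = 0 := (mul_eq_zero.mp hl).resolve_left hlam
    have h0 : c' + (d' - d) = 0 := by
      refine (mul_eq_zero.mp ?_).resolve_right (mul_ne_zero hlam (sub_ne_zero.mpr hxy))
      linear_combination ey - ex
    exact absurd (by linear_combination ex + (1 - lam + lam * x) * h0) hc

/-- The secant relations of a curve `v = r * u` with `r ^ 2 * (A + B * u ^ 2) = 1` cannot share
a slope `α ≠ 0` when the ratios `r` are strictly ordered. -/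
lemma secant_slopes_ne {α A u₁ u₂ u₃ r₁ r₂ r₃ : ℝ} (hα : α ≠ 0)
    (hu₁ : 0 < u₁) (hu₂ : 0 < u₂) (hu₃ : 0 < u₃) (hr₁ : 0 < r₁) (h12 : r₁ < r₂) (h23 : r₂ < r₃)
    (e12 : α * (r₁ * u₁ + r₂ * u₂) = A * (u₁ + u₂) * (r₁ ^ 2 * r₂ ^ 2))
    (e23 : α * (r₂ * u₂ + r₃ * u₃) = A * (u₂ + u₃) * (r₂ ^ 2 * r₃ ^ 2)) : False := by
  have hr₃ : 0 < r₃ := hr₁.trans (h12.trans h23)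
  have key : (r₁ * u₁ + r₂ * u₂) * ((u₂ + u₃) * r₃ ^ 2)
      = (r₂ * u₂ + r₃ * u₃) * ((u₁ + u₂) * r₁ ^ 2) := by
    refine mul_left_cancel₀ hα ?_
    linear_combination (u₂ + u₃) * r₃ ^ 2 * e12 - (u₁ + u₂) * r₁ ^ 2 * e23
  have lo : r₁ * (u₁ + u₂) < r₁ * u₁ + r₂ * u₂ := by
    linarith [mul_lt_mul_of_pos_right h12 hu₂]
  have hi : r₂ * u₂ + r₃ * u₃ < r₃ * (u₂ + u₃) := by
    linarith [mul_lt_mul_of_pos_right h23 hu₂]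
  have k1 := mul_lt_mul_of_pos_right lo (show 0 < (u₂ + u₃) * r₃ ^ 2 by positivity)
  have k2 := mul_lt_mul_of_pos_right hi (show 0 < (u₁ + u₂) * r₁ ^ 2 by positivity)
  have k3 := mul_lt_mul_of_pos_right (h12.trans h23)
    (show 0 < r₁ * r₃ * (u₁ + u₂) * (u₂ + u₃) by positivity)
  linarith

/-- Three distinct points of the curve `u ^ 2 = v ^ 2 * (A + B * u ^ 2)` in the open positive
quadrant lie on a nonhorizontal line only if `B = 0`. -/
lemma eq_zero_of_collinear {ι : Type*} {α γ A B : ℝ} {u v : ι → ℝ} (hα : α ≠ 0)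
    (hu : ∀ i, 0 < u i) (hv : ∀ i, 0 < v i)
    (hcurve : ∀ i, u i ^ 2 = v i ^ 2 * (A + B * u i ^ 2)) (hline : ∀ i, v i = α * u i + γ)
    {i j k : ι} (hij : u i ≠ u j) (hik : u i ≠ u k) (hjk : u j ≠ u k) : B = 0 := by
  by_contra hB
  obtain ⟨r, hr⟩ : ∃ r : ι → ℝ, ∀ a, v a = r a * u a :=
    ⟨fun a => v a / u a, fun a => (div_mul_cancel₀ _ (hu a).ne').symm⟩
  have hr0 : ∀ a, 0 < r a := fun a => pos_of_mul_pos_left (hr a ▸ hv a) (hu a).le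
  have hr1 : ∀ a, r a ^ 2 * (A + B * u a ^ 2) = 1 := fun a => by
    have h := hcurve a
    rw [hr a] at h
    refine mul_right_cancel₀ (pow_pos (hu a) 2).ne' ?_
    linear_combination -h
  have hne : ∀ a b, u a ≠ u b → r a ≠ r b := fun a b hab h => by
    have h1 := hr1 a
    rw [h] at h1
    have h2 : A + B * u a ^ 2 = A + B * u b ^ 2 :=
      mul_left_cancel₀ (pow_pos (hr0 b) 2).ne' (h1.trans (hr1 b).symm)
    have h3 : u a ^ 2 = u b ^ 2 := mul_left_cancel₀ hB (by linarith)
    exact hab ((pow_left_inj₀ (hu a).le (hu b).le two_ne_zero).mp h3)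
  have sec : ∀ a b, u a ≠ u b →
      α * (r a * u a + r b * u b) = A * (u a + u b) * (r a ^ 2 * r b ^ 2) := fun a b hab => by
    have hs : r a * u a - r b * u b = α * (u a - u b) := by
      rw [← hr a, ← hr b, hline a, hline b]; ring
    refine mul_right_cancel₀ (sub_ne_zero.mpr hab) ?_
    linear_combination -(r a * u a + r b * u b) * hs
      - r a ^ 2 * u a ^ 2 * hr1 b + r b ^ 2 * u b ^ 2 * hr1 a
  have main : ∀ a b c, u a ≠ u b → u b ≠ u c → r a < r b → r b < r c → False :=
    fun a b c hab hbc h1 h2 =>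
      secant_slopes_ne hα (hu a) (hu b) (hu c) (hr0 a) h1 h2 (sec a b hab) (sec b c hbc)
  rcases lt_or_gt_of_ne (hne _ _ hij) with h1 | h1 <;>
  rcases lt_or_gt_of_ne (hne _ _ hjk) with h2 | h2 <;>
  rcases lt_or_gt_of_ne (hne _ _ hik) with h3 | h3
  · exact main i j k hij hjk h1 h2
  · exact main i j k hij hjk h1 h2
  · exact main i k j hik hjk.symm h3 h2
  · exact main k i j hik.symm hij h3 h1
  · exact main j i k hij.symm hik h1 h3
  · exact main j k i hjk hik.symm h2 h3
  · exact main k j i hjk.symm hij.symm h2 h1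
  · exact main k j i hjk.symm hij.symm h2 h1


/-- Theorem 3(ii) (parsimonious Leroux CAR model, spectral form): if `λ_U ≠ λ_Z`
and `λ_U ≠ 0`, then all parameters, including the treatment effect `β`, are
identified. -/
theorem lcar_pars_identifiability_case2 {n : ℕ} (hn : 3 ≤ n)
    (ω : Fin n → ℝ) (hω : ∀ i, 0 ≤ ω i)
    (hdist : ∃ i j k : Fin n, ω i ≠ ω j ∧ ω i ≠ ω k ∧ ω j ≠ ω k)
    (hzero : ∃ i, ω i = 0)
    (β σZ lamZ σU lamU ρ σε2 : ℝ)
    (β' σZ' lamZ' σU' lamU' ρ' σε2' : ℝ)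
    (hσZ : 0 < σZ) (hσZ' : 0 < σZ') (hσU : 0 < σU) (hσU' : 0 < σU')
    (hlamZ : lamZ ∈ Set.Ico (0 : ℝ) 1) (hlamZ' : lamZ' ∈ Set.Ico (0 : ℝ) 1)
    (hlamU : lamU ∈ Set.Ico (0 : ℝ) 1) (hlamU' : lamU' ∈ Set.Ico (0 : ℝ) 1)
    (hρ : ρ ∈ Set.Icc (-1 : ℝ) 1) (hρ' : ρ' ∈ Set.Icc (-1 : ℝ) 1)
    (ha : ∀ i, σZ ^ 2 / (1 - lamZ + lamZ * ω i) = σZ' ^ 2 / (1 - lamZ' + lamZ' * ω i))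
    (hb : ∀ i, β + ρ * (σU / σZ) *
        Real.sqrt ((1 - lamZ + lamZ * ω i) / (1 - lamU + lamU * ω i))
      = β' + ρ' * (σU' / σZ') *
        Real.sqrt ((1 - lamZ' + lamZ' * ω i) / (1 - lamU' + lamU' * ω i)))
    (hc : ∀ i, (1 - ρ ^ 2) * σU ^ 2 / (1 - lamU + lamU * ω i) + σε2
      = (1 - ρ' ^ 2) * σU' ^ 2 / (1 - lamU' + lamU' * ω i) + σε2')
    (hUZne : lamU ≠ lamZ) (hU0 : lamU ≠ 0) :
    β' = β ∧ σZ' = σZ ∧ lamZ' = lamZ ∧ lamU' = lamU ∧ σU' = σU ∧ ρ' = ρ ∧ σε2' = σε2 := by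
  obtain ⟨i, j, k, hij, hik, hjk⟩ := hdist
  have pZ := fun a => leroux_pos hlamZ (hω a)
  have pU := fun a => leroux_pos hlamU (hω a)
  have pU' := fun a => leroux_pos hlamU' (hω a)
  have pZ' := fun a => leroux_pos hlamZ' (hω a)
  obtain ⟨hσ, rfl⟩ := leroux_variance_injective_s4 (pow_pos hσZ 2).ne' hij (pZ i).ne' (pZ j).ne'
    (pZ' i).ne' (pZ' j).ne' (ha i) (ha j)
  obtain rfl : σZ' = σZ := (pow_left_inj₀ hσZ'.le hσZ.le two_ne_zero).mp hσ
  have hinj : ∀ a b, ω a ≠ ω b →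
      √((1 - lamZ' + lamZ' * ω a) / (1 - lamU + lamU * ω a))
        ≠ √((1 - lamZ' + lamZ' * ω b) / (1 - lamU + lamU * ω b)) := by
    intro a b hab h
    rw [Real.sqrt_inj (div_pos (pZ a) (pU a)).le (div_pos (pZ b) (pU b)).le,
      div_eq_div_iff (pU a).ne' (pU b).ne'] at h
    refine hab (mul_left_cancel₀ (sub_ne_zero.mpr hUZne) ?_)
    linear_combination -h
  have hlam : lamU' = lamU := by
    by_cases hρ0 : ρ = 0
    · refine leroux_param_eq_of_variance_add_const (c := (1 - ρ ^ 2) * σU ^ 2) ?_ hU0 hij hik hjk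
        (pU i).ne' (pU j).ne' (pU k).ne' (pU' i).ne' (pU' j).ne' (pU' k).ne' (hc i) (hc j) (hc k)
      simp [hρ0, hσU.ne']
    · have hK : ρ * (σU / σZ') ≠ 0 := mul_ne_zero hρ0 (div_pos hσU hσZ).ne'
      have hK' : ρ' * (σU' / σZ') ≠ 0 := by
        intro h0
        have hi := hb i
        have hj := hb j
        rw [h0, zero_mul] at hi hj
        exact hinj i j hij (mul_left_cancel₀ hK (by linarith))
      have hd : lamU - lamZ' ≠ 0 := sub_ne_zero.mpr hUZne
      have hB := eq_zero_of_collinear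
        (u := fun a => √((1 - lamZ' + lamZ' * ω a) / (1 - lamU + lamU * ω a)))
        (v := fun a => √((1 - lamZ' + lamZ' * ω a) / (1 - lamU' + lamU' * ω a)))
        (α := ρ * (σU / σZ') / (ρ' * (σU' / σZ'))) (γ := (β - β') / (ρ' * (σU' / σZ')))
        (A := (lamU' - lamZ') / (lamU - lamZ')) (B := (lamU - lamU') / (lamU - lamZ'))
        (div_ne_zero hK hK') (fun a => Real.sqrt_pos.mpr (div_pos (pZ a) (pU a)))
        (fun a => Real.sqrt_pos.mpr (div_pos (pZ a) (pU' a)))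
        (fun a => by
          have h1 := (pU a).ne'
          have h2 := (pU' a).ne'
          simp only [Real.sq_sqrt (div_pos (pZ a) (pU a)).le,
            Real.sq_sqrt (div_pos (pZ a) (pU' a)).le]
          rw [div_mul_eq_mul_div, div_eq_div_iff h1 h2]
          generalize hL : 1 - lamU + lamU * ω a = L at h1 ⊢
          field_simp
          subst hL
          ring)
        (fun a => by
          rw [div_mul_eq_mul_div, ← add_div, eq_div_iff hK']
          linear_combination -hb a)
        (hinj i j hij) (hinj i k hik) (hinj j k hjk)
      exact (sub_eq_zero.mp ((div_eq_zero_iff.mp hB).resolve_right hd)).symm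
  subst hlam
  have hK : ρ * (σU / σZ') = ρ' * (σU' / σZ') :=
    mul_right_cancel₀ (sub_ne_zero.mpr (hinj i j hij)) (by linear_combination hb i - hb j)
  have hβ : β' = β := by
    have h := hb i
    rw [hK] at h
    linarith
  have hρσ : ρ * σU = ρ' * σU' := by
    rw [mul_div_assoc', mul_div_assoc'] at hK
    exact (div_left_inj' hσZ.ne').mp hK
  have hE : (1 - ρ ^ 2) * σU ^ 2 = (1 - ρ' ^ 2) * σU' ^ 2 := by
    have hinv : (1 - lamU' + lamU' * ω i)⁻¹ - (1 - lamU' + lamU' * ω j)⁻¹ ≠ 0 := by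
      intro h
      have h1 := inv_injective (sub_eq_zero.mp h)
      exact hij (mul_left_cancel₀ hU0 (by linarith))
    refine mul_right_cancel₀ hinv ?_
    have hi := hc i
    have hj := hc j
    simp only [div_eq_mul_inv] at hi hj
    linear_combination hi - hj
  have hε : σε2' = σε2 := by
    have h := hc i
    rw [hE] at h
    linarith
  have hσ2 : σU' ^ 2 = σU ^ 2 := by
    linear_combination -hE - (ρ * σU + ρ' * σU') * hρσ
  obtain rfl : σU' = σU := (pow_left_inj₀ hσU'.le hσU.le two_ne_zero).mp hσ2
  exact ⟨hβ, rfl, rfl, rfl, rfl, (mul_right_cancel₀ hσU.ne' hρσ).symm, hε⟩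
end

section
/- Let σ_Z, σ_U > 0, λ_Z, λ_U ∈ [0,1), ρ ∈ [−1,1] with ρ ≠ 0, β ∈ ℝ, σ_ε² ∈ ℝ, and set λ_UZ = λ_Z. Then there exist β̃ ∈ ℝ, ρ̃ ∈ [−1,1], σ̃_Z, σ̃_U > 0, λ̃_Z, λ̃_U, λ̃_UZ ∈ [0,1), and σ̃_ε² ∈ ℝ with β̃ ≠ β (one may take β̃ = β + 2ρσ_U/σ_Z, ρ̃ = −ρ, and all other tilde parameters equal to the corresponding untilded ones) such that for every ω ≥ 0: σ_Z²/(1−λ_Z+λ_Z ω) = σ̃_Z²/(1−λ̃_Z+λ̃_Z ω); β + (ρσ_U/σ_Z)·(1−λ_Z+λ_Z ω)/(1−λ_UZ+λ_UZ ω) = β̃ + (ρ̃σ̃_U/σ̃_Z)·(1−λ̃_Z+λ̃_Z ω)/(1−λ̃_UZ+λ̃_UZ ω); and σ_U²/(1−λ_U+λ_U ω) + σ_ε² − (ρσ_U)²·(1−λ_Z+λ_Z ω)/(1−λ_UZ+λ_UZ ω)² = σ̃_U²/(1−λ̃_U+λ̃_U ω) + σ̃_ε² − (ρ̃σ̃_U)²·(1−λ̃_Z+λ̃_Z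 ω)/(1−λ̃_UZ+λ̃_UZ ω)². -/
/-- Proposition A2 (non-identifiability for the non-parsimonious Leroux CAR
model when `ρ ≠ 0` and `λ_UZ = λ_Z`): there exists an alternative parameter set,
with a different treatment effect, satisfying all three observable families of
equations at every nonnegative `ω`. -/
theorem lcar_flex_nonidentifiability_lamUZ_eq_lamZ
    (σZ σU : ℝ) (hσZ : 0 < σZ) (hσU : 0 < σU)
    (lamZ lamU : ℝ) (hlamZ : lamZ ∈ Set.Ico (0 : ℝ) 1) (hlamU : lamU ∈ Set.Ico (0 : ℝ) 1)
    (ρ : ℝ) (hρ : ρ ∈ Set.Icc (-1 : ℝ) 1) (hρ0 : ρ ≠ 0)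
    (β σε2 : ℝ) (lamUZ : ℝ) (hUZ : lamUZ = lamZ) :
    ∃ (β' : ℝ) (ρ' : ℝ) (σZ' σU' : ℝ) (lamZ' lamU' lamUZ' : ℝ) (σε2' : ℝ),
      β' ≠ β ∧
      ρ' ∈ Set.Icc (-1 : ℝ) 1 ∧ 0 < σZ' ∧ 0 < σU' ∧
      lamZ' ∈ Set.Ico (0 : ℝ) 1 ∧ lamU' ∈ Set.Ico (0 : ℝ) 1 ∧ lamUZ' ∈ Set.Ico (0 : ℝ) 1 ∧
      (∀ ω : ℝ, 0 ≤ ω →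
        σZ ^ 2 / (1 - lamZ + lamZ * ω) = σZ' ^ 2 / (1 - lamZ' + lamZ' * ω)) ∧
      (∀ ω : ℝ, 0 ≤ ω →
        β + (ρ * σU / σZ) * ((1 - lamZ + lamZ * ω) / (1 - lamUZ + lamUZ * ω))
          = β' + (ρ' * σU' / σZ') * ((1 - lamZ' + lamZ' * ω) / (1 - lamUZ' + lamUZ' * ω))) ∧
      (∀ ω : ℝ, 0 ≤ ω →
        σU ^ 2 / (1 - lamU + lamU * ω) + σε2
            - (ρ * σU) ^ 2 * ((1 - lamZ + lamZ * ω) / (1 - lamUZ + lamUZ * ω) ^ 2)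
          = σU' ^ 2 / (1 - lamU' + lamU' * ω) + σε2'
            - (ρ' * σU') ^ 2 * ((1 - lamZ' + lamZ' * ω) / (1 - lamUZ' + lamUZ' * ω) ^ 2)) := by
  subst lamUZ
  obtain ⟨h0, h1⟩ := hlamZ
  refine ⟨β + 2 * (ρ * σU / σZ), -ρ, σZ, σU, lamZ, lamU, lamZ, σε2, ?_,
    ⟨neg_le_neg hρ.2, neg_le.mp hρ.1⟩, hσZ, hσU, ⟨h0, h1⟩, hlamU, ⟨h0, h1⟩,
    fun _ _ => rfl, fun ω hω => ?_, fun ω _ => by rw [neg_mul, neg_sq]⟩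
  · have : ρ * σU / σZ ≠ 0 := div_ne_zero (mul_ne_zero hρ0 hσU.ne') hσZ.ne'
    simpa using this
  · have hpos : 0 < 1 - lamZ + lamZ * ω :=
      add_pos_of_pos_of_nonneg (sub_pos.mpr h1) (mul_nonneg h0 hω)
    rw [div_self hpos.ne']
    ring
end

section
/- Let β ∈ ℝ, σ_Z, σ_U > 0, and ρ ∈ [−1,1]. Then there exist β̃ ∈ ℝ, σ̃_U > 0, and ρ̃ ∈ [−1,1] such that β̃ ≠ β, β + ρσ_U/σ_Z = β̃ + ρ̃σ̃_U/σ_Z, and (1−ρ²)σ_U² = (1−ρ̃²)σ̃_U². -/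
/-- Proposition A4 (non-identifiability for the parsimonious Leroux CAR model
when `λ_U = λ_Z`): there exist alternative parameters `(β̃, σ̃_U, ρ̃)` with
`β̃ ≠ β` matching the two observable scalar equations. -/
theorem lcar_pars_nonidentifiability_lamU_eq_lamZ
    (β : ℝ) (σZ σU : ℝ) (hσZ : 0 < σZ) (hσU : 0 < σU)
    (ρ : ℝ) (hρ : ρ ∈ Set.Icc (-1 : ℝ) 1) :
    ∃ (β' σU' ρ' : ℝ), 0 < σU' ∧ ρ' ∈ Set.Icc (-1 : ℝ) 1 ∧ β' ≠ β ∧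
      β + ρ * σU / σZ = β' + ρ' * σU' / σZ ∧
      (1 - ρ ^ 2) * σU ^ 2 = (1 - ρ' ^ 2) * σU' ^ 2 := by
  rcases eq_or_ne ρ 0 with rfl | h
  · refine ⟨β - 3 / 4 * σU / σZ, 5 / 4 * σU, 3 / 5, by positivity, by norm_num, ?_, by ring,
      by ring⟩
    have : 0 < 3 / 4 * σU / σZ := by positivity
    linarith
  · refine ⟨β + 2 * (ρ * σU / σZ), σU, -ρ, hσU, ⟨by linarith [hρ.2], by linarith [hρ.1]⟩, ?_,
      by ring, by ring⟩
    have : ρ * σU / σZ ≠ 0 := div_ne_zero (mul_ne_zero h hσU.ne') hσZ.ne'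
    simpa using this
end

section
/- Let n ≥ 2 and let W be a connected proximity matrix with D its diagonal matrix of (positive) column sums and D^{-1/2} W D^{-1/2} = Γ Λ Γᵀ a spectral decomposition. Let τ_U, τ_ε > 0 and φ_U ≠ 0 with I − φ_U Λ positive definite, and let τ̃_U, τ̃_ε > 0 and φ̃_U with I − φ̃_U Λ positive definite. If D has at least two distinct diagonal entries and τ_U^{-1} (I − φ_U Λ)^{-1} + τ_ε^{-1} Γᵀ D Γ = τ̃_U^{-1} (I − φ̃_U Λ)^{-1} + τ̃_ε^{-1} Γᵀ D Γ, then τ̃_U = τ_U, φ̃_U = φ_U, and τ̃_ε = τ_ε. -/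
open Matrix

/-- A matrix commutes with the inverse of any invertible affine function of itself. -/
lemma Matrix.commute_inv_one_sub_smul {ι : Type*} [Fintype ι] [DecidableEq ι]
    (M : Matrix ι ι ℝ) (a : ℝ) (h : IsUnit (1 - a • M).det) :
    Commute (1 - a • M)⁻¹ M := by
  have hc : M * (1 - a • M) = (1 - a • M) * M := by
    simp [mul_sub, sub_mul]
  calc (1 - a • M)⁻¹ * M = (1 - a • M)⁻¹ * (M * (1 - a • M)) * (1 - a • M)⁻¹ := by
        rw [mul_assoc, mul_assoc, Matrix.mul_nonsing_inv _ h, mul_one]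
    _ = M * (1 - a • M)⁻¹ := by
        rw [hc, ← mul_assoc, Matrix.nonsing_inv_mul _ h, one_mul]

/-- If `diagonal d` commutes with `A`, then `d` is constant along any walk through
nonzero entries of `A`. -/
lemma Matrix.eq_of_commute_diagonal_of_walk {ι : Type*} [Fintype ι] [DecidableEq ι]
    {A : Matrix ι ι ℝ} {d : ι → ℝ} (h : Commute (diagonal d) A) {m : ℕ}
    (l : Fin (m + 1) → ι) (hl : ∀ r : Fin m, A (l r.castSucc) (l r.succ) ≠ 0)
    (k : Fin (m + 1)) : d (l k) = d (l 0) := by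
  induction k using Fin.induction with
  | zero => rfl
  | succ r ih =>
    rw [← ih]
    have := congrFun (congrFun h.eq (l r.castSucc)) (l r.succ)
    rw [diagonal_mul, mul_diagonal, mul_comm] at this
    exact (mul_left_cancel₀ (hl r) this).symm

/-- Equal scaled inverses give equal rescaled matrices. -/
lemma Matrix.smul_eq_smul_of_inv_smul_inv_eq {ι : Type*} [Fintype ι] [DecidableEq ι]
    {M N : Matrix ι ι ℝ} {a b : ℝ} (ha : a ≠ 0) (hb : b ≠ 0)
    (hM : IsUnit M.det) (hN : IsUnit N.det) (h : a⁻¹ • M⁻¹ = b⁻¹ • N⁻¹) :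
    a • M = b • N := by
  have h1 := congrArg (fun X => (a * b) • (M * X * N)) h
  simp only [Matrix.mul_smul, Matrix.smul_mul, Matrix.mul_nonsing_inv _ hM, one_mul,
    mul_assoc, Matrix.nonsing_inv_mul _ hN, mul_one, smul_smul] at h1
  rw [← mul_assoc, ← mul_assoc, mul_right_comm, mul_inv_cancel₀ ha, one_mul,
    mul_inv_cancel_right₀ hb] at h1
  exact h1.symm

/-- Lemma A1(i): identification of `(τ_U, φ_U, τ_ε)` from the conditional variance
of `Y` given `Z` in the CAR model, when the connected proximity matrix has a
degree matrix `D` with at least two distinct diagonal entries. -/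
theorem car_condvar_identification_distinct_degrees {n : ℕ} (hn : 2 ≤ n)
    (W : Matrix (Fin n) (Fin n) ℝ)
    (hWsymm : W.IsSymm)
    (hWnonneg : ∀ i j, 0 ≤ W i j)
    (hWdiag : ∀ i, W i i = 0)
    (hWconn : ∀ i j : Fin n, i ≠ j → ∃ (m : ℕ) (l : Fin (m + 1) → Fin n),
      l 0 = i ∧ l (Fin.last m) = j ∧ ∀ r : Fin m, 0 < W (l r.castSucc) (l r.succ))
    (d : Fin n → ℝ) (hd : ∀ i, d i = ∑ j, W j i) (hdpos : ∀ i, 0 < d i)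
    (Γ Λ : Matrix (Fin n) (Fin n) ℝ)
    (hΓ : Γ * Γᵀ = 1) (hΓ' : Γᵀ * Γ = 1)
    (hΛdiag : ∃ lam : Fin n → ℝ, Λ = Matrix.diagonal lam)
    (hspec : (Matrix.diagonal fun i => (Real.sqrt (d i))⁻¹) * W *
        (Matrix.diagonal fun i => (Real.sqrt (d i))⁻¹) = Γ * Λ * Γᵀ)
    (τU φU τε τU' φU' τε' : ℝ)
    (hτU : 0 < τU) (hτε : 0 < τε) (hφU : φU ≠ 0)
    (hτU' : 0 < τU') (hτε' : 0 < τε')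
    (hpd : (1 - φU • Λ).PosDef) (hpd' : (1 - φU' • Λ).PosDef)
    (hD : ∃ i j : Fin n, d i ≠ d j)
    (heq : τU⁻¹ • (1 - φU • Λ)⁻¹ + τε⁻¹ • (Γᵀ * Matrix.diagonal d * Γ)
      = τU'⁻¹ • (1 - φU' • Λ)⁻¹ + τε'⁻¹ • (Γᵀ * Matrix.diagonal d * Γ)) :
    τU' = τU ∧ φU' = φU ∧ τε' = τε := by
  have hu : IsUnit (1 - φU • Λ).det := hpd.det_pos.ne'.isUnit
  have hu' : IsUnit (1 - φU' • Λ).det := hpd'.det_pos.ne'.isUnit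
  have hs : ∀ i, (Real.sqrt (d i))⁻¹ ≠ 0 := fun i => inv_ne_zero (Real.sqrt_pos.2 (hdpos i)).ne'
  have hA : ∀ i j, (Γ * Λ * Γᵀ) i j = (Real.sqrt (d i))⁻¹ * W i j * (Real.sqrt (d j))⁻¹ := by
    intro i j
    rw [← hspec, mul_diagonal, diagonal_mul]
  have hε : τε' = τε := by
    by_contra hne
    have hc : τε'⁻¹ - τε⁻¹ ≠ 0 := sub_ne_zero.2 fun h => hne (inv_injective h)
    have hE : Γᵀ * diagonal d * Γ = (τε'⁻¹ - τε⁻¹)⁻¹ •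
        (τU⁻¹ • (1 - φU • Λ)⁻¹ - τU'⁻¹ • (1 - φU' • Λ)⁻¹) := by
      rw [eq_inv_smul_iff₀ hc, sub_smul, sub_eq_sub_iff_add_eq_add, add_comm, ← heq, add_comm]
    have hcomm : Commute (Γᵀ * diagonal d * Γ) Λ := by
      rw [hE]
      exact (((commute_inv_one_sub_smul Λ φU hu).smul_left _).sub_left
        ((commute_inv_one_sub_smul Λ φU' hu').smul_left _)).smul_left _
    have hDA : Commute (diagonal d) (Γ * Λ * Γᵀ) := by
      calc diagonal d * (Γ * Λ * Γᵀ)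
          = (Γ * Γᵀ) * diagonal d * (Γ * Λ * Γᵀ) := by rw [hΓ, one_mul]
        _ = Γ * ((Γᵀ * diagonal d * Γ) * Λ) * Γᵀ := by simp only [mul_assoc]
        _ = Γ * (Λ * (Γᵀ * diagonal d * Γ)) * Γᵀ := by rw [hcomm.eq]
        _ = Γ * Λ * Γᵀ * diagonal d * (Γ * Γᵀ) := by simp only [mul_assoc]
        _ = Γ * Λ * Γᵀ * diagonal d := by rw [hΓ, mul_one]
    obtain ⟨i, j, hij⟩ := hD
    obtain ⟨m, l, rfl, rfl, hl⟩ := hWconn i j fun h => hij (congrArg d h)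
    refine hij (eq_of_commute_diagonal_of_walk hDA l (fun r => ?_) _).symm
    rw [hA]
    exact mul_ne_zero (mul_ne_zero (hs _) (hl r).ne') (hs _)
  subst hε
  have hM := smul_eq_smul_of_inv_smul_inv_eq hτU.ne' hτU'.ne' hu hu' (add_right_cancel heq)
  have hconj : ∀ t p : ℝ, Γ * (t • (1 - p • Λ)) * Γᵀ = t • (1 - p • (Γ * Λ * Γᵀ)) := by
    intro t p
    simp [mul_sub, sub_mul, hΓ]
  have hN : τU • (1 - φU • (Γ * Λ * Γᵀ)) = τU' • (1 - φU' • (Γ * Λ * Γᵀ)) := by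
    rw [← hconj, ← hconj, hM]
  obtain ⟨i, _⟩ := hD
  have hτ : τU' = τU := by
    have := congrFun (congrFun hN i) i
    simpa [hA, hWdiag] using this.symm
  subst hτ
  obtain ⟨j, -, hj⟩ := Finset.exists_ne_zero_of_sum_ne_zero (hd i ▸ (hdpos i).ne')
  have hAj : (Γ * Λ * Γᵀ) j i ≠ 0 := by
    rw [hA]
    exact mul_ne_zero (mul_ne_zero (hs _) hj) (hs _)
  have hji := congrFun (congrFun hN j) i
  simp only [Matrix.smul_apply, Matrix.sub_apply, smul_eq_mul] at hji
  exact ⟨rfl, mul_right_cancel₀ hAj (sub_right_injective (mul_left_cancel₀ hτU.ne' hji)).symm, rfl⟩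
end

section
/- Let n ≥ 2 and let W be a proximity matrix with D its diagonal matrix of (positive) column sums and D^{-1/2} W D^{-1/2} = Γ Λ Γᵀ a spectral decomposition. Let τ_U > 0 and φ_U ≠ 0 be such that I − φ_U Λ is positive definite. Let (β, ρ, τ_Z) and (β̃, ρ̃, τ̃_Z) be real parameters with τ_Z, τ̃_Z > 0. If β I + ρ √(τ_Z/τ_U) (I − φ_U Λ)^{-1} = β̃ I + ρ̃ √(τ̃_Z/τ_U) (I − φ_U Λ)^{-1}, then β = β̃ and ρ√τ_Z = ρ̃√τ̃_Z. -/
open Matrix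

/-- The identity and the inverse of a non-scalar invertible matrix are linearly independent. -/
theorem Matrix.smul_one_add_smul_inv_inj {ι K : Type*} [Fintype ι] [DecidableEq ι] [Nonempty ι]
    [Field K] {M : Matrix ι ι K} (hM : IsUnit M.det)
    (hscalar : ∀ c : K, M ≠ c • (1 : Matrix ι ι K)) {a b a' b' : K}
    (h : a • (1 : Matrix ι ι K) + b • M⁻¹ = a' • (1 : Matrix ι ι K) + b' • M⁻¹) :
    a = a' ∧ b = b' := by
  have hmul := congrArg (· * M) h
  simp only [add_mul, smul_mul_assoc, one_mul, Matrix.nonsing_inv_mul M hM] at hmul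
  have hlin : (a - a') • M = (b' - b) • (1 : Matrix ι ι K) := by
    rw [sub_smul, sub_smul, sub_eq_sub_iff_add_eq_add, hmul, add_comm]
  have ha : a = a' := by
    by_contra hne
    apply hscalar ((a - a')⁻¹ * (b' - b))
    rw [mul_smul, ← hlin, inv_smul_smul₀ (sub_ne_zero.mpr hne)]
  refine ⟨ha, ?_⟩
  rw [ha, sub_self, zero_smul, eq_comm, smul_eq_zero, or_iff_left one_ne_zero] at hlin
  exact (sub_eq_zero.mp hlin).symm

/-- A matrix with zero diagonal which becomes scalar after scaling its rows and columns by
nonzero factors vanishes. -/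
theorem Matrix.eq_zero_of_diagonal_mul_mul_diagonal_eq_smul_one {ι K : Type*} [Fintype ι]
    [DecidableEq ι] [Field K] {W : Matrix ι ι K} {e : ι → K} (hW : ∀ i, W i i = 0)
    (he : ∀ i, e i ≠ 0) {s : K} (h : diagonal e * W * diagonal e = s • (1 : Matrix ι ι K)) :
    W = 0 := by
  ext i j
  by_cases hij : i = j
  · subst hij
    exact hW i
  · have := congrFun (congrFun h i) j
    simpa [Matrix.mul_diagonal, Matrix.diagonal_mul, Matrix.one_apply_ne hij, he] using this

/-- Lemma A2: identification of `β` and `ρ√τ_Z` from the regression coefficient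
matrix `Cov(Y,Z) Var(Z)⁻¹` (up to conjugation) in the CAR spatial confounding
model. -/
theorem car_regression_coefficient_identification {n : ℕ} (hn : 2 ≤ n)
    (W : Matrix (Fin n) (Fin n) ℝ)
    (hWsymm : W.IsSymm)
    (hWnonneg : ∀ i j, 0 ≤ W i j)
    (hWdiag : ∀ i, W i i = 0)
    (d : Fin n → ℝ) (hd : ∀ i, d i = ∑ j, W j i) (hdpos : ∀ i, 0 < d i)
    (Γ Λ : Matrix (Fin n) (Fin n) ℝ)
    (hΓ : Γ * Γᵀ = 1) (hΓ' : Γᵀ * Γ = 1)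
    (hΛdiag : ∃ lam : Fin n → ℝ, Λ = Matrix.diagonal lam)
    (hspec : (Matrix.diagonal fun i => (Real.sqrt (d i))⁻¹) * W *
        (Matrix.diagonal fun i => (Real.sqrt (d i))⁻¹) = Γ * Λ * Γᵀ)
    (τU φU : ℝ) (hτU : 0 < τU) (hφU : φU ≠ 0)
    (hpd : (1 - φU • Λ).PosDef)
    (β ρ τZ β' ρ' τZ' : ℝ) (hτZ : 0 < τZ) (hτZ' : 0 < τZ')
    (heq : β • (1 : Matrix (Fin n) (Fin n) ℝ) +
        (ρ * Real.sqrt (τZ / τU)) • (1 - φU • Λ)⁻¹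
      = β' • (1 : Matrix (Fin n) (Fin n) ℝ) +
        (ρ' * Real.sqrt (τZ' / τU)) • (1 - φU • Λ)⁻¹) :
    β = β' ∧ ρ * Real.sqrt τZ = ρ' * Real.sqrt τZ' := by
  have : Nonempty (Fin n) := ⟨⟨0, by omega⟩⟩
  have hscalar (c : ℝ) : 1 - φU • Λ ≠ c • (1 : Matrix (Fin n) (Fin n) ℝ) := by
    intro hc
    have hΛ : Λ = (φU⁻¹ * (1 - c)) • (1 : Matrix (Fin n) (Fin n) ℝ) := by
      rw [mul_smul, sub_smul, one_smul, ← hc, sub_sub_cancel, inv_smul_smul₀ hφU]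
    rw [hΛ, mul_smul_comm, mul_one, smul_mul_assoc, hΓ] at hspec
    have hW := Matrix.eq_zero_of_diagonal_mul_mul_diagonal_eq_smul_one hWdiag
      (fun i => inv_ne_zero (Real.sqrt_ne_zero'.mpr (hdpos i))) hspec
    have h0 := hdpos ⟨0, by omega⟩
    simp [hd, hW] at h0
  obtain ⟨hβ, hρ⟩ := Matrix.smul_one_add_smul_inv_inj hpd.det_pos.ne'.isUnit hscalar heq
  refine ⟨hβ, ?_⟩
  rwa [Real.sqrt_div hτZ.le, Real.sqrt_div hτZ'.le, ← mul_div_assoc, ← mul_div_assoc,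
    div_left_inj' (Real.sqrt_ne_zero'.mpr hτU)] at hρ
end

section
/- Let n ≥ 2 and let W be a proximity matrix with D its diagonal matrix of (positive) column sums and D^{-1/2} W D^{-1/2} = Γ Λ Γᵀ a spectral decomposition. Let φ_U be such that I − φ_U Λ is positive definite. Let (τ_Z, φ_Z, ρ) and (τ̃_Z, φ̃_Z, ρ̃) be real parameters with τ_Z, τ̃_Z > 0 and ρ√τ_Z = ρ̃√τ̃_Z. If τ_Z (I − φ_Z Λ − ρ² (I − φ_U Λ)^{-1}) = τ̃_Z (I − φ̃_Z Λ − ρ̃² (I − φ_U Λ)^{-1}), then τ_Z = τ̃_Z, φ_Z = φ̃_Z, and ρ = ρ̃. -/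
open Matrix

/-- A diagonal congruence of a matrix with zero diagonal has trace zero. -/
theorem trace_diagonal_mul_mul_diagonal_eq_zero {ι R : Type*} [Fintype ι] [DecidableEq ι]
    [CommRing R] (c e : ι → R) {W : Matrix ι ι R} (hW : ∀ i, W i i = 0) :
    (Matrix.diagonal c * W * Matrix.diagonal e).trace = 0 := by
  simp [Matrix.trace, Matrix.mul_diagonal, Matrix.diagonal_mul, hW]

/-- A diagonal congruence with nonvanishing weights is injective at zero. -/
theorem eq_zero_of_diagonal_mul_mul_diagonal_eq_zero {ι R : Type*} [Fintype ι] [DecidableEq ι]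
    [CommRing R] [IsDomain R] {c e : ι → R} {W : Matrix ι ι R} (hc : ∀ i, c i ≠ 0)
    (he : ∀ i, e i ≠ 0) (h : Matrix.diagonal c * W * Matrix.diagonal e = 0) : W = 0 := by
  ext i j
  have hij := congrFun (congrFun h i) j
  simpa [Matrix.mul_diagonal, Matrix.diagonal_mul, hc i, he j] using hij

/-- Lemma A3: identification of `(τ_Z, φ_Z, ρ)` from the precision matrix of `Z`
(up to conjugation) in the CAR spatial confounding model, given that
`ρ√τ_Z = ρ̃√τ̃_Z`. -/
theorem car_precision_identification {n : ℕ} (hn : 2 ≤ n)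
    (W : Matrix (Fin n) (Fin n) ℝ)
    (hWsymm : W.IsSymm)
    (hWnonneg : ∀ i j, 0 ≤ W i j)
    (hWdiag : ∀ i, W i i = 0)
    (d : Fin n → ℝ) (hd : ∀ i, d i = ∑ j, W j i) (hdpos : ∀ i, 0 < d i)
    (Γ Λ : Matrix (Fin n) (Fin n) ℝ)
    (hΓ : Γ * Γᵀ = 1) (hΓ' : Γᵀ * Γ = 1)
    (hΛdiag : ∃ lam : Fin n → ℝ, Λ = Matrix.diagonal lam)
    (hspec : (Matrix.diagonal fun i => (Real.sqrt (d i))⁻¹) * W *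
        (Matrix.diagonal fun i => (Real.sqrt (d i))⁻¹) = Γ * Λ * Γᵀ)
    (φU : ℝ) (hpd : (1 - φU • Λ).PosDef)
    (τZ φZ ρ τZ' φZ' ρ' : ℝ) (hτZ : 0 < τZ) (hτZ' : 0 < τZ')
    (hρτ : ρ * Real.sqrt τZ = ρ' * Real.sqrt τZ')
    (heq : τZ • ((1 : Matrix (Fin n) (Fin n) ℝ) - φZ • Λ - (ρ ^ 2) • (1 - φU • Λ)⁻¹)
      = τZ' • ((1 : Matrix (Fin n) (Fin n) ℝ) - φZ' • Λ - (ρ' ^ 2) • (1 - φU • Λ)⁻¹)) :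
    τZ = τZ' ∧ φZ = φZ' ∧ ρ = ρ' := by
  have htr : Λ.trace = 0 := by
    have h := trace_diagonal_mul_mul_diagonal_eq_zero
      (fun i => (Real.sqrt (d i))⁻¹) (fun i => (Real.sqrt (d i))⁻¹) hWdiag
    rwa [hspec, Matrix.trace_mul_comm, ← Matrix.mul_assoc, hΓ', Matrix.one_mul] at h
  have hΛ : Λ ≠ 0 := by
    rintro rfl
    have hc : ∀ i, (Real.sqrt (d i))⁻¹ ≠ 0 := fun i =>
      inv_ne_zero (Real.sqrt_pos.2 (hdpos i)).ne'
    have hW : W = 0 := eq_zero_of_diagonal_mul_mul_diagonal_eq_zero hc hc (by simpa using hspec)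
    have h := hdpos ⟨0, by omega⟩
    simp [hd, hW] at h
  have hsq : τZ * ρ ^ 2 = τZ' * ρ' ^ 2 := by
    have h := congrArg (· ^ 2) hρτ
    simp only [mul_pow, Real.sq_sqrt hτZ.le, Real.sq_sqrt hτZ'.le] at h
    linarith
  have hlin : τZ • (1 : Matrix (Fin n) (Fin n) ℝ) - (τZ * φZ) • Λ
      = τZ' • (1 : Matrix (Fin n) (Fin n) ℝ) - (τZ' * φZ') • Λ := by
    simpa only [smul_sub, smul_smul, hsq, sub_left_inj] using heq
  have hτ : τZ = τZ' := by
    have h := congrArg Matrix.trace hlin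
    have hn0 : n ≠ 0 := by omega
    simpa [Matrix.trace_sub, Matrix.trace_smul, htr, hn0] using h
  subst hτ
  refine ⟨rfl, ?_, mul_right_cancel₀ (Real.sqrt_pos.2 hτZ).ne' hρτ⟩
  exact mul_left_cancel₀ hτZ.ne' (smul_left_injective ℝ hΛ (sub_right_injective hlin))
end

section
/- Let n ≥ 2 be an integer, σ² > 0, λ < 1, and let ω_1, …, ω_n be nonnegative reals containing at least two distinct values, such that 1−λ+λω_i > 0 for all i. If σ̃² > 0 and λ̃ < 1 satisfy 1−λ̃+λ̃ω_i > 0 and σ²/(1−λ+λω_i) = σ̃²/(1−λ̃+λ̃ω_i) for every i = 1, …, n, then σ̃² = σ² and λ̃ = λ. -/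
/-- Lemma A5 (`lem:lcar-varz`): identification of the variance `σ²` and spatial
dependence parameter `λ` from the spectral-domain variances
`σ²/(1−λ+λω_i)`, provided the `ω_i` contain at least two distinct values. -/
theorem lcar_varz_identification {n : ℕ} (hn : 2 ≤ n)
    (σ2 : ℝ) (hσ2 : 0 < σ2) (lam : ℝ) (hlam : lam < 1)
    (ω : Fin n → ℝ) (hω : ∀ i, 0 ≤ ω i)
    (hdist : ∃ i j : Fin n, ω i ≠ ω j)
    (hden : ∀ i, 0 < 1 - lam + lam * ω i)
    (σ2' : ℝ) (hσ2' : 0 < σ2') (lam' : ℝ) (hlam' : lam' < 1)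
    (hden' : ∀ i, 0 < 1 - lam' + lam' * ω i)
    (heq : ∀ i, σ2 / (1 - lam + lam * ω i) = σ2' / (1 - lam' + lam' * ω i)) :
    σ2' = σ2 ∧ lam' = lam := by
  obtain ⟨i, j, hij⟩ := hdist
  have cross (k : Fin n) :
      σ2 * (1 - lam' + lam' * ω k) = σ2' * (1 - lam + lam * ω k) :=
    (div_eq_div_iff (hden k).ne' (hden' k).ne').mp (heq k)
  have slope : σ2 * lam' = σ2' * lam :=
    mul_right_cancel₀ (sub_ne_zero.mpr hij) (by linear_combination cross i - cross j)
  have variance : σ2' = σ2 := by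
    linear_combination (ω i - 1) * slope - cross i
  subst variance
  exact ⟨rfl, mul_left_cancel₀ hσ2.ne' slope⟩
end

section
/- Let K ∈ {1, 2, 3}, let λ_1, …, λ_K ∈ (0,1) be mutually distinct, and let a_1, …, a_K, b be real numbers. If the equation a_1/(1−λ_1+λ_1 ω) + ⋯ + a_K/(1−λ_K+λ_K ω) + b = 0 holds for at least K+1 distinct nonnegative values of ω, then a_1 = ⋯ = a_K = b = 0. -/
open Polynomial in
/-- A sum of simple fractions with pairwise non-proportional non-constant affine denominators, plus
a constant, which vanishes at more points than there are fractions has only zero coefficients. -/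
theorem sum_div_affine_add_const_eq_zero {F ι : Type*} [Field F] [Fintype ι]
    (p q a : ι → F) (b : F) (S : Finset F)
    (hq : ∀ k, q k ≠ 0) (hpq : ∀ j k, j ≠ k → p j * q k ≠ p k * q j)
    (hS : Fintype.card ι < S.card) (hne : ∀ ω ∈ S, ∀ k, p k + q k * ω ≠ 0)
    (heq : ∀ ω ∈ S, (∑ k, a k / (p k + q k * ω)) + b = 0) :
    (∀ k, a k = 0) ∧ b = 0 := by
  classical
  let L : ι → F[X] := fun k => C (p k) + C (q k) * X
  have L_eval (k : ι) (x : F) : (L k).eval x = p k + q k * x := by simp [L]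
  have L_deg (k : ι) : (L k).natDegree ≤ 1 := by
    dsimp only [L]
    compute_degree
  have prod_deg (s : Finset ι) : (∏ j ∈ s, L j).natDegree ≤ Fintype.card ι := by
    calc (∏ j ∈ s, L j).natDegree ≤ ∑ j ∈ s, (L j).natDegree := natDegree_prod_le _ _
      _ ≤ ∑ _j ∈ s, 1 := Finset.sum_le_sum fun j _ => L_deg j
      _ ≤ Fintype.card ι := by simpa using Finset.card_le_univ s
  let P : F[X] := (∑ k, C (a k) * ∏ j ∈ Finset.univ.erase k, L j) + C b * ∏ j, L j
  have P_deg : P.natDegree ≤ Fintype.card ι :=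
    natDegree_add_le_of_degree_le
      (natDegree_sum_le_of_forall_le _ _ fun k _ => (natDegree_C_mul_le _ _).trans (prod_deg _))
      ((natDegree_C_mul_le _ _).trans (prod_deg _))
  have P_eval (x : F) : P.eval x =
      (∑ k, a k * ∏ j ∈ Finset.univ.erase k, (p j + q j * x)) + b * ∏ j, (p j + q j * x) := by
    simp only [P, eval_add, eval_finsetSum, eval_mul, eval_C, eval_prod, L_eval]
  have P_zero : P = 0 := by
    refine eq_zero_of_natDegree_lt_card_of_eval_eq_zero' P S (fun ω hω => ?_)
      (P_deg.trans_lt hS)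
    have h := congrArg (· * ∏ j, (p j + q j * ω)) (heq ω hω)
    simp only [zero_mul, add_mul, Finset.sum_mul] at h
    rw [P_eval, ← h]
    congr 1
    refine Finset.sum_congr rfl fun k _ => ?_
    rw [← Finset.mul_prod_erase _ _ (Finset.mem_univ k), ← mul_assoc,
      div_mul_cancel₀ _ (hne ω hω k)]
  have ha (k : ι) : a k = 0 := by
    have root : p k + q k * (-p k / q k) = 0 := by
      field_simp [hq k]
      ring
    have h := P_eval (-p k / q k)
    rw [P_zero, eval_zero, Finset.prod_eq_zero (Finset.mem_univ k) root, mul_zero, add_zero,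
      Finset.sum_eq_single k] at h
    · refine (mul_eq_zero.mp h.symm).resolve_right (Finset.prod_ne_zero_iff.mpr fun j hj h0 => ?_)
      apply hpq j k (Finset.ne_of_mem_erase hj)
      have hk := hq k
      field_simp at h0
      linear_combination h0
    · intro j _ hj
      rw [Finset.prod_eq_zero (Finset.mem_erase.mpr ⟨hj.symm, Finset.mem_univ k⟩) root, mul_zero]
    · simp
  obtain ⟨ω, hω⟩ := Finset.card_pos.mp (Nat.zero_lt_of_lt hS)
  exact ⟨ha, by simpa [ha] using heq ω hω⟩

/-- Lemma A6 (`lem:lcar-expression-linear-independence`): for `K ∈ {1,2,3}` and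
mutually distinct `λ_1, …, λ_K ∈ (0,1)`, if
`a_1/(1−λ_1+λ_1ω) + ⋯ + a_K/(1−λ_K+λ_Kω) + b = 0` holds for at least `K+1`
distinct nonnegative values of `ω`, then `a_1 = ⋯ = a_K = b = 0`. -/
theorem lcar_expression_linear_independence (K : ℕ) (hK : 1 ≤ K) (hK3 : K ≤ 3)
    (lam : Fin K → ℝ) (hlam : ∀ k, lam k ∈ Set.Ioo (0 : ℝ) 1)
    (hlamdist : Function.Injective lam)
    (a : Fin K → ℝ) (b : ℝ)
    (S : Finset ℝ) (hScard : K + 1 ≤ S.card) (hSnonneg : ∀ ω ∈ S, 0 ≤ ω)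
    (heq : ∀ ω ∈ S, (∑ k, a k / (1 - lam k + lam k * ω)) + b = 0) :
    (∀ k, a k = 0) ∧ b = 0 := by
  refine sum_div_affine_add_const_eq_zero (fun k => 1 - lam k) lam a b S (fun k => (hlam k).1.ne')
    (fun j k hjk h => hjk (hlamdist ?_)) (by simpa using hScard) (fun ω hω k => ?_) heq
  · linear_combination -h
  · have h0 := mul_nonneg (hlam k).1.le (hSnonneg ω hω)
    have h1 := (hlam k).2
    exact (by linarith : 0 < 1 - lam k + lam k * ω).ne'
end

section
/- Let r_1, r_2, r_3 ∈ [0,1) with r_2 > r_1. Then the function ω ↦ (√(1+r_2 ω) + √(1+r_3 ω)) / (√(1+r_1 ω) + √(1+r_3 ω)) is strictly increasing on (0, ∞). -/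
/-- For `0 ≤ p` and `0 ≤ q`,
the function `ω ↦ √(1 + p ω) √(1 + q ω) / ω` is decreasing in `ω > 0`. -/
lemma mul_sqrt_mul_sqrt_le {p q x y : ℝ} (hp : 0 ≤ p) (hq : 0 ≤ q) (hx : 0 < x) (hxy : x ≤ y) :
    x * (√(1 + p * y) * √(1 + q * y)) ≤ y * (√(1 + p * x) * √(1 + q * x)) := by
  have hy : 0 < y := hx.trans_le hxy
  have key {r : ℝ} (hr : 0 ≤ r) : x * (1 + r * y) ≤ y * (1 + r * x) := by nlinarith
  refine abs_le_of_sq_le_sq' ?_ (by positivity) |>.2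
  simp only [mul_pow]
  rw [Real.sq_sqrt (by positivity), Real.sq_sqrt (by positivity), Real.sq_sqrt (by positivity),
    Real.sq_sqrt (by positivity)]
  have := mul_le_mul (key hp) (key hq) (by positivity) (by positivity)
  linarith

/-- For `0 ≤ p < q`, the ratio `√(1 + q ω) / √(1 + p ω)` is strictly increasing in `ω > 0`. -/
lemma sqrt_mul_sqrt_lt {p q x y : ℝ} (hp : 0 ≤ p) (hpq : p < q) (hx : 0 < x) (hxy : x < y) :
    √(1 + p * y) * √(1 + q * x) < √(1 + q * y) * √(1 + p * x) := by
  have hq : 0 < q := hp.trans_lt hpq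
  have hy : 0 < y := hx.trans hxy
  rw [← Real.sqrt_mul (by positivity), ← Real.sqrt_mul (by positivity)]
  apply Real.sqrt_lt_sqrt (by positivity)
  nlinarith [mul_pos (sub_pos.2 hpq) (sub_pos.2 hxy)]

/-- For `0 ≤ p < q` and `0 ≤ s`, the ratio `(√(1 + q ω) - √(1 + p ω)) / √(1 + s ω)` is
increasing in `ω > 0`. -/
lemma sqrt_mul_sub_sqrt_le {p q s x y : ℝ} (hp : 0 ≤ p) (hpq : p < q) (hs : 0 ≤ s) (hx : 0 < x)
    (hxy : x ≤ y) :
    √(1 + s * y) * (√(1 + q * x) - √(1 + p * x)) ≤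
      √(1 + s * x) * (√(1 + q * y) - √(1 + p * y)) := by
  have hq : 0 < q := hp.trans_lt hpq
  have hy : 0 < y := hx.trans_le hxy
  have diff {z : ℝ} (hz : 0 < z) :
      √(1 + q * z) - √(1 + p * z) = (q - p) * z / (√(1 + q * z) + √(1 + p * z)) := by
    have h1 := Real.sq_sqrt (show 0 ≤ 1 + q * z by positivity)
    have h2 := Real.sq_sqrt (show 0 ≤ 1 + p * z by positivity)
    rw [eq_div_iff (by positivity)]
    linarith
  rw [diff hx, diff hy, ← mul_div_assoc, ← mul_div_assoc,
    div_le_div_iff₀ (by positivity) (by positivity)]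
  have h := mul_le_mul_of_nonneg_left
    (add_le_add (mul_sqrt_mul_sqrt_le hs hq.le hx hxy) (mul_sqrt_mul_sqrt_le hs hp hx hxy))
    (sub_pos.2 hpq).le
  linarith


/-- Lemma A8 (`lem:lcar-pars-strictly-increasing2`): for `r_1, r_2, r_3 ∈ [0,1)`
with `r_2 > r_1`, the function
`ω ↦ (√(1+r_2ω) + √(1+r_3ω)) / (√(1+r_1ω) + √(1+r_3ω))` is strictly increasing
on `(0, ∞)`. -/
theorem lcar_pars_ratio_strictly_increasing
    (r1 r2 r3 : ℝ)
    (hr1 : r1 ∈ Set.Ico (0 : ℝ) 1) (hr2 : r2 ∈ Set.Ico (0 : ℝ) 1)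
    (hr3 : r3 ∈ Set.Ico (0 : ℝ) 1) (h12 : r1 < r2) :
    StrictMonoOn (fun ω : ℝ =>
      (Real.sqrt (1 + r2 * ω) + Real.sqrt (1 + r3 * ω)) /
        (Real.sqrt (1 + r1 * ω) + Real.sqrt (1 + r3 * ω)))
      (Set.Ioi (0 : ℝ)) := by
  intro x hx y hy hxy
  rw [Set.mem_Ioi] at hx hy
  have p1 := hr1.1
  have p3 := hr3.1
  have h1 := sqrt_mul_sqrt_lt p1 h12 hx hxy
  have h2 := sqrt_mul_sub_sqrt_le p1 h12 p3 hx hxy.le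
  dsimp only
  rw [div_lt_div_iff₀ (by positivity) (by positivity)]
  linarith
end

section
/- Let f : (0,∞) → (0,∞) be strictly monotonic and differentiable. Then for every positive integer K, for any mutually distinct real exponents ψ_1, …, ψ_K, any mutually distinct positive reals w_1, …, w_K, and any reals a_1, …, a_K: if a_1 f(w)^{ψ_1} + a_2 f(w)^{ψ_2} + ⋯ + a_K f(w)^{ψ_K} = 0 for every w ∈ {w_1, …, w_K}, then a_1 = ⋯ = a_K = 0. In other words, the family of functions {f(·)^{ψ} : ψ ∈ ℝ} is K-linearly independent with respect to any collection of K distinct values in (0,∞). -/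
/-- An exponential sum with `n` distinct real frequencies that vanishes at `n` distinct real points
has zero coefficients. -/
theorem eq_zero_of_sum_mul_exp_eq_zero {ι : Type*} (ψ : ι → ℝ) (n : ℕ) (s : Finset ι)
    (hs : s.card = n) (hψ : Set.InjOn ψ s) (c : ι → ℝ) (x : Fin n → ℝ) (hx : StrictMono x)
    (h : ∀ j, ∑ i ∈ s, c i * Real.exp (ψ i * x j) = 0) : ∀ i ∈ s, c i = 0 := by
  classical
  induction n generalizing s c with
  | zero => simp [Finset.card_eq_zero.mp hs]
  | succ n ih =>
    obtain ⟨k, hk⟩ : s.Nonempty := Finset.card_pos.mp (by omega)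
    set g : ℝ → ℝ := fun t => ∑ i ∈ s, c i * Real.exp ((ψ i - ψ k) * t) with hg
    have hderiv (t : ℝ) : HasDerivAt g
        (∑ i ∈ s, c i * (Real.exp ((ψ i - ψ k) * t) * (ψ i - ψ k))) t :=
      HasDerivAt.fun_sum fun i _ =>
        (by simpa using ((hasDerivAt_id t).const_mul (ψ i - ψ k)).exp.const_mul (c i))
    have hzero (j : Fin (n + 1)) : g (x j) = 0 := by
      have hfactor : g (x j) = Real.exp (-(ψ k * x j)) * ∑ i ∈ s, c i * Real.exp (ψ i * x j) := by
        rw [hg, Finset.mul_sum]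
        refine Finset.sum_congr rfl fun i _ => ?_
        rw [mul_left_comm, ← Real.exp_add]
        ring_nf
      rw [hfactor, h j, mul_zero]
    have hrolle (j : Fin n) : ∃ y ∈ Set.Ioo (x j.castSucc) (x j.succ),
        ∑ i ∈ s, c i * (Real.exp ((ψ i - ψ k) * y) * (ψ i - ψ k)) = 0 :=
      exists_hasDerivAt_eq_zero (hx j.castSucc_lt_succ)
        (fun t _ => (hderiv t).continuousAt.continuousWithinAt)
        ((hzero _).trans (hzero _).symm) fun t _ => hderiv t
    choose y hy hy0 using hrolle
    have hymono : StrictMono y := fun a b hab =>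
      (hy a).2.trans_le ((hx.monotone (Fin.succ_le_castSucc_iff.mpr hab)).trans (hy b).1.le)
    have hne : ∀ i ∈ s.erase k, c i * (ψ i - ψ k) = 0 := by
      refine ih (s.erase k) (by rw [Finset.card_erase_of_mem hk, hs]; rfl)
        (hψ.mono (Finset.coe_subset.mpr (s.erase_subset k))) (fun i => c i * (ψ i - ψ k))
        y hymono fun j => ?_
      have hfactor : ∑ i ∈ s, c i * (ψ i - ψ k) * Real.exp (ψ i * y j) = Real.exp (ψ k * y j) *
          ∑ i ∈ s, c i * (Real.exp ((ψ i - ψ k) * y j) * (ψ i - ψ k)) := by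
        rw [Finset.mul_sum]
        refine Finset.sum_congr rfl fun i _ => ?_
        rw [show ψ i * y j = ψ k * y j + (ψ i - ψ k) * y j by ring, Real.exp_add]
        ring
      rw [Finset.sum_erase _ (by simp), hfactor, hy0, mul_zero]
    have hother : ∀ i ∈ s, i ≠ k → c i = 0 := fun i hi hik =>
      (mul_eq_zero.mp (hne i (Finset.mem_erase.mpr ⟨hik, hi⟩))).resolve_right
        (sub_ne_zero.mpr fun e => hik (hψ hi hk e))
    intro i hi
    by_cases hik : i = k
    · subst hik
      have h0 := h 0
      rw [Finset.sum_eq_single_of_mem i hi fun l hl hli => by rw [hother l hl hli, zero_mul]] at h0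
      exact (mul_eq_zero.mp h0).resolve_right (Real.exp_ne_zero _)
    · exact hother i hi hik


/-- Lemma A10 (`lem:k-linind-generalized`): for a strictly monotone differentiable
`f : (0,∞) → (0,∞)`, the family `{f(·)^ψ : ψ ∈ ℝ}` is `K`-linearly independent
with respect to any collection of `K` distinct values in `(0,∞)`. -/
theorem power_family_K_linear_independence
    (f : ℝ → ℝ) (hfpos : ∀ x, 0 < x → 0 < f x)
    (hfmono : StrictMonoOn f (Set.Ioi (0 : ℝ)) ∨ StrictAntiOn f (Set.Ioi (0 : ℝ)))
    (hfdiff : ∀ x ∈ Set.Ioi (0 : ℝ), DifferentiableAt ℝ f x)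
    (K : ℕ) (hK : 0 < K)
    (ψ : Fin K → ℝ) (hψ : Function.Injective ψ)
    (w : Fin K → ℝ) (hwpos : ∀ i, 0 < w i) (hw : Function.Injective w)
    (a : Fin K → ℝ)
    (heq : ∀ j, (∑ i, a i * (f (w j)) ^ (ψ i)) = 0) :
    ∀ i, a i = 0 := by
  have hfinj : Set.InjOn f (Set.Ioi 0) := hfmono.elim StrictMonoOn.injOn StrictAntiOn.injOn
  have hlog : Function.Injective fun j => Real.log (f (w j)) := fun i j hij =>
    hw (hfinj (hwpos i) (hwpos j)
      (Real.log_injOn_pos (hfpos _ (hwpos i)) (hfpos _ (hwpos j)) hij))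
  set T : Finset ℝ := Finset.univ.image fun j => Real.log (f (w j)) with hTdef
  have hT : T.card = K := by
    rw [hTdef, Finset.card_image_of_injective _ hlog, Finset.card_univ, Fintype.card_fin]
  intro i
  refine eq_zero_of_sum_mul_exp_eq_zero ψ K Finset.univ (by simp) hψ.injOn a
    (T.orderEmbOfFin hT) (T.orderEmbOfFin hT).strictMono (fun j => ?_) i (Finset.mem_univ i)
  obtain ⟨l, -, hl⟩ := Finset.mem_image.mp (T.orderEmbOfFin_mem hT j)
  rw [← hl, ← heq l]
  refine Finset.sum_congr rfl fun m _ => ?_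
  rw [Real.rpow_def_of_pos (hfpos _ (hwpos l)), mul_comm (ψ m)]
end

section
/- For any real numbers φ > φ' > 0, there exist infinitely many w > 0 such that sin(w/φ)/(w/φ) = sin(w/φ')/(w/φ'); equivalently, for every real α > 1 the set {z > 0 : α·sin(z) = sin(α z)} is infinite. Consequently, for any finite integer M ≥ 1, the family of wave covariance functions f_φ(w) = sin(w/φ)/(w/φ) (with f_φ(0) = 1), φ > 0, may fail to be 2-linearly independent with respect to a set of size M. -/
theorem infinite_setOf_pos_mul_sin_eq_sin_mul {α : ℝ} (hα : 1 < α) :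
    {z : ℝ | 0 < z ∧ α * Real.sin z = Real.sin (α * z)}.Infinite := by
  refine Set.infinite_of_forall_exists_gt fun a => ?_
  obtain ⟨n, hn⟩ := exists_nat_gt |a|
  have hpi := Real.pi_gt_three
  have hn0 : (0 : ℝ) ≤ n := n.cast_nonneg
  have hn_le : (n : ℝ) ≤ n * (2 * Real.pi) := by nlinarith
  have hcont : ContinuousOn (fun z : ℝ => α * Real.sin z - Real.sin (α * z))
      (Set.Icc (Real.pi / 2 + n * (2 * Real.pi))
        (Real.pi / 2 + Real.pi + n * (2 * Real.pi))) := by fun_prop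
  have hmem : (0 : ℝ) ∈ Set.Icc
      (α * Real.sin (Real.pi / 2 + Real.pi + n * (2 * Real.pi)) -
        Real.sin (α * (Real.pi / 2 + Real.pi + n * (2 * Real.pi))))
      (α * Real.sin (Real.pi / 2 + n * (2 * Real.pi)) -
        Real.sin (α * (Real.pi / 2 + n * (2 * Real.pi)))) := by
    rw [Real.sin_add_nat_mul_two_pi, Real.sin_add_nat_mul_two_pi, Real.sin_add_pi,
      Real.sin_pi_div_two]
    constructor
    · linarith [Real.neg_one_le_sin (α * (Real.pi / 2 + Real.pi + n * (2 * Real.pi)))]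
    · linarith [Real.sin_le_one (α * (Real.pi / 2 + n * (2 * Real.pi)))]
  obtain ⟨z, hz, hz0⟩ := intermediate_value_Icc' (by linarith) hcont hmem
  refine ⟨z, ⟨?_, sub_eq_zero.mp hz0⟩, ?_⟩
  · linarith [hz.1]
  · linarith [hz.1, le_abs_self a]

/-- Proposition A7 (`prop:wave-cov-not-k-distinguishable`): any two wave
covariance functions with distinct positive range parameters agree at infinitely
many positive distances; equivalently, for every `α > 1` the set
`{z > 0 : α sin z = sin(α z)}` is infinite. Hence for any finite `M ≥ 1` the
wave covariance family may fail to be 2-linearly independent with respect to a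
set of size `M`. -/
theorem wave_covariance_not_distinguishable :
    (∀ φ φ' : ℝ, 0 < φ' → φ' < φ →
      {w : ℝ | 0 < w ∧
        Real.sin (w / φ) / (w / φ) = Real.sin (w / φ') / (w / φ')}.Infinite) ∧
    (∀ α : ℝ, 1 < α →
      {z : ℝ | 0 < z ∧ α * Real.sin z = Real.sin (α * z)}.Infinite) := by
  refine ⟨fun φ φ' hφ' hlt => ?_, fun α hα => infinite_setOf_pos_mul_sin_eq_sin_mul hα⟩
  have hφ : 0 < φ := hφ'.trans hlt
  refine ((infinite_setOf_pos_mul_sin_eq_sin_mul ((one_lt_div hφ').mpr hlt)).image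
    (mul_right_injective₀ hφ.ne').injOn).mono ?_
  rintro _ ⟨z, ⟨hz, hsin⟩, rfl⟩
  refine ⟨mul_pos hφ hz, ?_⟩
  change Real.sin (φ * z / φ) / (φ * z / φ) = Real.sin (φ * z / φ') / (φ * z / φ')
  rw [mul_div_cancel_left₀ z hφ.ne', mul_div_right_comm, ← hsin]
  field_simp
end
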